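/- Let (R, m) be a complete Noetherian local ring, a an ideal, and M a finitely generated R-module. Then f^1_a(M) = inf{ i ∈ ℕ : H^i_a(M) is not minimax }. -/

import Mathlib

open CategoryTheory

universe u

/-- An `R`-module `M` is *in dimension `< n`* if there is a finitely generated submodule `N`
of `M` such that the Krull dimension of `Supp (M/N)` is `< n`. -/
def InDimLT (R : Type u) [CommRing R] (M : Type u) [AddCommGroup M] [Module R M]
    (n : ℕ) : Prop :=
  ∃ N : Submodule R M, N.FG ∧
    Order.krullDim (Module.support R (M ⧸ N)) < (n : WithBot ℕ∞)

/-- `f_a(M)`: the least `i` such that `H^i_a(M)` is not finitely generated (`⊤` if none). -/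
noncomputable def fDim (R : Type u) [CommRing R] (a : Ideal R)
    (M : Type u) [AddCommGroup M] [Module R M] : ℕ∞ :=
  sInf {i : ℕ∞ | ∃ j : ℕ, i = j ∧
    ¬ Module.Finite R ((localCohomology a j).obj (ModuleCat.of R M))}

/-- `f^n_a(M) = inf { f_{aR_p}(M_p) : p ∈ Supp(M/aM), dim R/p ≥ n }`. -/
noncomputable def fDimN (R : Type u) [CommRing R] (a : Ideal R)
    (M : Type u) [AddCommGroup M] [Module R M] (n : ℕ) : ℕ∞ :=
  sInf {i : ℕ∞ | ∃ p : PrimeSpectrum R,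
    p ∈ Module.support R (M ⧸ (a • ⊤ : Submodule R M)) ∧
    (n : WithBot ℕ∞) ≤ ringKrullDim (R ⧸ p.asIdeal) ∧
    i = fDim (Localization.AtPrime p.asIdeal)
          (a.map (algebraMap R (Localization.AtPrime p.asIdeal)))
          (LocalizedModule p.asIdeal.primeCompl M)}

/-- `h^n_a(M)`: the least `i` such that `H^i_a(M)` is not in dimension `< n` (`⊤` if none). -/
noncomputable def hDim (R : Type u) [CommRing R] (a : Ideal R)
    (M : Type u) [AddCommGroup M] [Module R M] (n : ℕ) : ℕ∞ :=
  sInf {i : ℕ∞ | ∃ j : ℕ, i = j ∧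
    ¬ InDimLT R ((localCohomology a j).obj (ModuleCat.of R M)) n}

noncomputable section

open Limits

namespace LocCoh

section Comparison

variable {R : Type u} [CommRing R]

/-- The map induced by a chain map on the complexes of homomorphisms into `Y`. -/
def linearYonedaObjMap {X X' : ChainComplex (ModuleCat.{u} R) ℕ} (φ : X ⟶ X')
    (Y : ModuleCat.{u} R) : X'.linearYonedaObj R Y ⟶ X.linearYonedaObj R Y :=
  (HomologicalComplex.unopFunctor _ _).map
    ((((linearYoneda R (ModuleCat.{u} R)).obj Y).rightOp.mapHomologicalComplex _).map φ).op

lemma unop_naturality {C : Type*} [Category* C] {A A' B B' : Cᵒᵖ} {D D' : C} (e : A ≅ B)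
    (e' : A' ≅ B') (f : A' ⟶ A) (b : B' ⟶ B) (k : B ≅ Opposite.op D) (k' : B' ≅ Opposite.op D')
    (d : D ⟶ D') (h1 : e'.inv ≫ f = b ≫ e.inv) (h2 : b ≫ k.hom = k'.hom ≫ d.op) :
    f.unop ≫ e'.inv.unop ≫ k'.inv.unop = (e.inv.unop ≫ k.inv.unop) ≫ d := by
  apply Quiver.Hom.op_inj
  change (k'.inv ≫ e'.inv) ≫ f = d.op ≫ k.inv ≫ e.inv
  rw [Category.assoc, h1, ← Category.assoc, ← Category.assoc, ← (Iso.inv_comp_eq k').2 h2]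
  simp

lemma isoExt_naturality {X X' Y : ModuleCat.{u} R} (P : ProjectiveResolution X)
    (P' : ProjectiveResolution X') {g : X' ⟶ X} (φ : ProjectiveResolution.Hom P' P g) (n : ℕ) :
    ((Ext R (ModuleCat.{u} R) n).map g.op).app Y ≫ (P'.isoExt n Y).hom =
      (P.isoExt n Y).hom ≫ HomologicalComplex.homologyMap (linearYonedaObjMap φ.hom Y) n :=
  unop_naturality
    (P.isoLeftDerivedObj ((linearYoneda R (ModuleCat.{u} R)).obj Y).rightOp n)
    (P'.isoLeftDerivedObj ((linearYoneda R (ModuleCat.{u} R)).obj Y).rightOp n)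
    _ _ ((P.complex.linearYonedaObj R Y).homologyOp n)
    ((P'.complex.linearYonedaObj R Y).homologyOp n) _
    (ProjectiveResolution.isoLeftDerivedObj_inv_naturality g P' P φ.hom
      (by simpa using φ.hom_f_zero_comp_π_f_zero)
      ((linearYoneda R (ModuleCat.{u} R)).obj Y).rightOp n)
    (HomologicalComplex.homologyOp_hom_naturality (linearYonedaObjMap φ.hom Y) n)

lemma exists_linearEquiv_of_ker_eq {A B C : Type*} [AddCommGroup A] [AddCommGroup B]
    [AddCommGroup C] [Module R A] [Module R B] [Module R C] (p : A →ₗ[R] B) (q : A →ₗ[R] C)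
    (hp : Function.Surjective p) (hq : Function.Surjective q)
    (h : LinearMap.ker p = LinearMap.ker q) : ∃ e : B ≃ₗ[R] C, ∀ x, e (p x) = q x := by
  refine ⟨(p.quotKerEquivOfSurjective hp).symm ≪≫ₗ Submodule.quotEquivOfEq _ _ h ≪≫ₗ
    q.quotKerEquivOfSurjective hq, fun x => ?_⟩
  have : (p.quotKerEquivOfSurjective hp).symm (p x) = Submodule.Quotient.mk x := by
    rw [LinearEquiv.symm_apply_eq]; rfl
  simp [this]

variable {X Y : ModuleCat.{u} R} (P : ProjectiveResolution X)

lemma extMk_smul {n : ℕ} (r : R) (f : P.complex.X n ⟶ Y) (m : ℕ) (hm : n + 1 = m)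
    (hf : P.complex.d m n ≫ f = 0) :
    P.extMk (r • f) m hm (by simp [hf]) = r • P.extMk f m hm hf := by
  have := P.extMk_comp_mk₀ f m hm hf (r • 𝟙 Y)
  simp only [Linear.comp_smul, Category.comp_id] at this
  rw [← this]
  simp [Abelian.Ext.mk₀_smul]

/-- The morphism underlying a cocycle. -/
def cocycleHom (n : ℕ) :
    (P.complex.linearYonedaObj R Y).cycles n →ₗ[R] (P.complex.X n ⟶ Y) :=
  ((P.complex.linearYonedaObj R Y).iCycles n).hom

lemma cocycleHom_comp (n : ℕ) (z : (P.complex.linearYonedaObj R Y).cycles n) :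
    P.complex.d (n + 1) n ≫ cocycleHom P n z = 0 :=
  congrArg (fun f => f.hom z) ((P.complex.linearYonedaObj R Y).iCycles_d n (n + 1))

lemma cocycleHom_injective (n : ℕ) : Function.Injective (cocycleHom (Y := Y) P n) :=
  (ModuleCat.mono_iff_injective ((P.complex.linearYonedaObj R Y).iCycles n)).1 inferInstance

lemma exists_cocycleHom_eq (n : ℕ) (f : P.complex.X n ⟶ Y)
    (hf : P.complex.d (n + 1) n ≫ f = 0) : ∃ z, cocycleHom P n z = f := by
  let k : ModuleCat.of R R ⟶ (P.complex.linearYonedaObj R Y).X n :=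
    ModuleCat.ofHom (LinearMap.toSpanSingleton R (P.complex.X n ⟶ Y) f)
  have hk : k ≫ (P.complex.linearYonedaObj R Y).d n (n + 1) = 0 := by
    ext
    change P.complex.d (n + 1) n ≫ ((1 : R) • f) = 0
    simp [hf]
  refine ⟨((P.complex.linearYonedaObj R Y).liftCycles k (n + 1) (by simp) hk).hom (1 : R), ?_⟩
  have := congrArg (fun f => f.hom (1 : R))
    ((P.complex.linearYonedaObj R Y).liftCycles_i k (n + 1) (by simp) hk)
  refine this.trans ?_
  exact one_smul R f

lemma homologyπ_eq_zero_iff (n : ℕ) (z : (P.complex.linearYonedaObj R Y).cycles n) :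
    ((P.complex.linearYonedaObj R Y).homologyπ n).hom z = 0 ↔
      ∃ g : P.complex.X (n - 1) ⟶ Y, P.complex.d n (n - 1) ≫ g = cocycleHom P n z := by
  let K := P.complex.linearYonedaObj R Y
  have hex : (ShortComplex.mk (K.toCycles (n - 1) n) (K.homologyπ n) (by simp)).Exact :=
    ShortComplex.exact_of_g_is_cokernel _ (K.homologyIsCokernel (n - 1) n (by cases n <;> simp))
  rw [ShortComplex.moduleCat_exact_iff] at hex
  have key (g : P.complex.X (n - 1) ⟶ Y) :
      cocycleHom P n ((K.toCycles (n - 1) n).hom g) = P.complex.d n (n - 1) ≫ g :=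
    congrArg (fun f => f.hom g) (K.toCycles_i (n - 1) n)
  constructor
  · intro h
    obtain ⟨(g : P.complex.X (n - 1) ⟶ Y), hg⟩ := hex z h
    refine ⟨g, ?_⟩
    rw [← key]
    exact congrArg _ hg
  · rintro ⟨g, hg⟩
    rw [← key] at hg
    rw [← cocycleHom_injective P n hg]
    exact congrArg (fun f => f.hom g) (K.toCycles_comp_homologyπ (n - 1) n)

/-- The map from the cocycles computing the derived functor version of `Ext` to the derived
category version. -/
def cyclesToExt (n : ℕ) :
    (P.complex.linearYonedaObj R Y).cycles n →ₗ[R] Abelian.Ext X Y n where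
  toFun z := P.extMk (cocycleHom P n z) (n + 1) rfl (cocycleHom_comp P n z)
  map_add' z w := by
    simp [P.add_extMk]
  map_smul' r z := by
    simp [← extMk_smul P]

lemma cyclesToExt_surjective (n : ℕ) :
    Function.Surjective (cyclesToExt (Y := Y) P n) := by
  intro x
  obtain ⟨f, hf, rfl⟩ := P.extMk_surjective x (n + 1) rfl
  obtain ⟨z, rfl⟩ := exists_cocycleHom_eq P n f hf
  exact ⟨z, rfl⟩

lemma extMk_zero_degree_eq_zero (f : P.complex.X 0 ⟶ Y) (hf : P.complex.d 1 0 ≫ f = 0)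
    (h : P.extMk f 1 rfl hf = 0) : f = 0 := by
  rw [← P.extEquivCohomologyClass.apply_eq_iff_eq,
    ProjectiveResolution.extEquivCohomologyClass_extMk,
    ProjectiveResolution.extEquivCohomologyClass_zero,
    CochainComplex.HomComplex.CohomologyClass.mk_eq_zero_iff,
    CochainComplex.HomComplex.Cocycle.toSingleMk_mem_coboundaries_iff _ _ _ _ _ (1 : ℤ)
      (by simp)] at h
  obtain ⟨g, hg⟩ := h
  have h0 : IsZero (P.cochainComplex.X 1) := P.cochainComplex.isZero_of_isStrictlyLE 0 1
  rw [h0.eq_of_src g 0, comp_zero] at hg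
  rw [← cancel_epi (P.cochainComplexXIso (-((0 : ℕ) : ℤ)) 0 (by simp)).hom, comp_zero]
  exact hg.symm

lemma ker_cyclesToExt (n : ℕ) :
    LinearMap.ker ((P.complex.linearYonedaObj R Y).homologyπ n).hom =
      LinearMap.ker (cyclesToExt (Y := Y) P n) := by
  ext z
  rw [LinearMap.mem_ker, LinearMap.mem_ker, homologyπ_eq_zero_iff]
  cases n with
  | zero =>
    constructor
    · rintro ⟨g, hg⟩
      have : cocycleHom P 0 z = 0 := by rw [← hg]; simp
      simp [cyclesToExt, this]
    · intro h
      refine ⟨0, ?_⟩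
      rw [extMk_zero_degree_eq_zero P _ (cocycleHom_comp P 0 z) h]
      simp
  | succ n => exact (P.extMk_eq_zero_iff (cocycleHom P (n + 1) z) (n + 2) rfl
      (cocycleHom_comp P (n + 1) z) n rfl).symm

lemma exists_linearEquiv_ext (n : ℕ) (Y : ModuleCat.{u} R) :
    ∃ e : ((Ext R (ModuleCat.{u} R) n).obj (Opposite.op X)).obj Y ≃ₗ[R] Abelian.Ext X Y n,
      ∀ z, e ((P.isoExt n Y).inv.hom (((P.complex.linearYonedaObj R Y).homologyπ n).hom z)) =
        cyclesToExt P n z := by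
  obtain ⟨e, he⟩ := exists_linearEquiv_of_ker_eq
    ((P.complex.linearYonedaObj R Y).homologyπ n).hom (cyclesToExt P n)
    ((ModuleCat.epi_iff_surjective _).1 inferInstance) (cyclesToExt_surjective P n)
    (ker_cyclesToExt P n)
  exact ⟨(P.isoExt n Y).toLinearEquiv ≪≫ₗ e, fun z => by simp [he]⟩

/-- The comparison isomorphism between the two versions of `Ext`. -/
def extEquiv (X Y : ModuleCat.{u} R) (n : ℕ) :
    ((Ext R (ModuleCat.{u} R) n).obj (Opposite.op X)).obj Y ≃ₗ[R] Abelian.Ext X Y n :=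
  (exists_linearEquiv_ext (projectiveResolution X) n Y).choose

lemma extEquiv_naturality {X X' : ModuleCat.{u} R} (g : X' ⟶ X) (Y : ModuleCat.{u} R) (n : ℕ)
    (x : ((Ext R (ModuleCat.{u} R) n).obj (Opposite.op X)).obj Y) :
    extEquiv X' Y n ((((Ext R (ModuleCat.{u} R) n).map g.op).app Y).hom x) =
      (Abelian.Ext.mk₀ g).comp (extEquiv X Y n x) (zero_add n) := by
  let P := projectiveResolution X
  let P' := projectiveResolution X'
  let φ : ProjectiveResolution.Hom P' P g :=
    ⟨ProjectiveResolution.lift g P' P, by simpa using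
      ProjectiveResolution.lift_commutes_zero g P' P⟩
  have hs : Function.Surjective ((P.complex.linearYonedaObj R Y).homologyπ n).hom :=
    (ModuleCat.epi_iff_surjective _).1 inferInstance
  obtain ⟨y, rfl⟩ : ∃ y, (P.isoExt n Y).inv.hom y = x :=
    ⟨(P.isoExt n Y).hom.hom x, by simp⟩
  obtain ⟨z, rfl⟩ := hs y
  have h1 := (exists_linearEquiv_ext P n Y).choose_spec z
  have h2 := (exists_linearEquiv_ext P' n Y).choose_spec
    ((HomologicalComplex.cyclesMap (linearYonedaObjMap φ.hom Y) n).hom z)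
  have h3 : (((Ext R (ModuleCat.{u} R) n).map g.op).app Y).hom
      ((P.isoExt n Y).inv.hom (((P.complex.linearYonedaObj R Y).homologyπ n).hom z)) =
      (P'.isoExt n Y).inv.hom (((P'.complex.linearYonedaObj R Y).homologyπ n).hom
      ((HomologicalComplex.cyclesMap (linearYonedaObjMap φ.hom Y) n).hom z)) := by
    have h4 : (P.isoExt n Y).inv ≫ ((Ext R (ModuleCat.{u} R) n).map g.op).app Y =
        HomologicalComplex.homologyMap (linearYonedaObjMap φ.hom Y) n ≫ (P'.isoExt n Y).inv := by
      rw [Iso.inv_comp_eq, ← Category.assoc, Iso.eq_comp_inv, isoExt_naturality P P' φ n]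
    have h5 := HomologicalComplex.homologyπ_naturality (linearYonedaObjMap φ.hom Y) n
    have h4' := fun w => congrArg (fun f => f.hom w) h4
    have h5' := congrArg (fun f => f.hom z) h5
    refine (h4' _).trans ?_
    exact congrArg (P'.isoExt n Y).inv.hom h5'
  rw [h3]
  refine h2.trans ?_
  refine Eq.trans ?_ (congrArg (fun w => (Abelian.Ext.mk₀ g).comp w (zero_add n)) h1).symm
  change _ = (Abelian.Ext.mk₀ g).comp (P.extMk (cocycleHom P n z) (n + 1) rfl
    (cocycleHom_comp P n z)) _
  rw [ProjectiveResolution.mk₀_comp_extMk _ _ _ _ φ]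
  change P'.extMk (cocycleHom P' n ((HomologicalComplex.cyclesMap
    (linearYonedaObjMap φ.hom Y) n).hom z)) (n + 1) rfl (cocycleHom_comp P' n _) = _
  congr 1
  exact congrArg (fun f => f.hom z)
    (HomologicalComplex.cyclesMap_i (linearYonedaObjMap φ.hom Y) n)

end Comparison

section Model

variable {R : Type u} [CommRing R] (a : Ideal R)

/-- The quotient map between quotients by powers of an ideal. -/
def powFactor {s t : ℕ} (h : s ≤ t) : ModuleCat.of R (R ⧸ a ^ t) ⟶ ModuleCat.of R (R ⧸ a ^ s) :=
  ModuleCat.ofHom (Submodule.mapQ _ _ LinearMap.id (Ideal.pow_le_pow_right h))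

lemma powFactor_self (t : ℕ) : powFactor a (le_refl t) = 𝟙 _ := by
  ext; simp [powFactor]

lemma powFactor_comp {r s t : ℕ} (h : r ≤ s) (h' : s ≤ t) :
    powFactor a h' ≫ powFactor a h = powFactor a (h.trans h') := by
  ext; simp [powFactor]

/-- The transition maps of the system whose colimit is local cohomology. -/
def extTransition (j : ℕ) (M : ModuleCat.{u} R) (s t : ℕ) (h : s ≤ t) :
    Abelian.Ext (ModuleCat.of R (R ⧸ a ^ s)) M j →ₗ[R]
      Abelian.Ext (ModuleCat.of R (R ⧸ a ^ t)) M j :=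
  Abelian.Ext.precompOfLinear (Abelian.Ext.mk₀ (powFactor a h)) R M (zero_add j)

lemma extTransition_apply {j : ℕ} {M : ModuleCat.{u} R} {s t : ℕ} (h : s ≤ t)
    (x : Abelian.Ext (ModuleCat.of R (R ⧸ a ^ s)) M j) :
    extTransition a j M s t h x = (Abelian.Ext.mk₀ (powFactor a h)).comp x (zero_add j) := rfl

instance (j : ℕ) (M : ModuleCat.{u} R) :
    DirectedSystem (fun t : ℕ => Abelian.Ext (ModuleCat.of R (R ⧸ a ^ t)) M j)
      (fun s t h => extTransition a j M s t h) where
  map_self t x := by simp [extTransition_apply, powFactor_self]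
  map_map r s t hrs hst x := by
    rw [extTransition_apply, extTransition_apply, extTransition_apply,
      Abelian.Ext.mk₀_comp_mk₀_assoc, powFactor_comp]

/-- Local cohomology as the direct limit of `Ext (R ⧸ a ^ t) M`. -/
def LC (j : ℕ) (M : ModuleCat.{u} R) : Type u :=
  Module.DirectLimit (fun t : ℕ => Abelian.Ext (ModuleCat.of R (R ⧸ a ^ t)) M j)
    (extTransition a j M)

instance (j : ℕ) (M : ModuleCat.{u} R) : AddCommGroup (LC a j M) :=
  inferInstanceAs (AddCommGroup (Module.DirectLimit _ _))

instance (j : ℕ) (M : ModuleCat.{u} R) : Module R (LC a j M) :=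
  inferInstanceAs (Module R (Module.DirectLimit _ _))

namespace LC

variable {a} {j : ℕ} {M : ModuleCat.{u} R}

/-- The structure maps of the direct limit. -/
def of (t : ℕ) : Abelian.Ext (ModuleCat.of R (R ⧸ a ^ t)) M j →ₗ[R] LC a j M :=
  Module.DirectLimit.of R ℕ _ (extTransition a j M) t

lemma exists_of (x : LC a j M) : ∃ t y, of t y = x := Module.DirectLimit.exists_of x

lemma of_transition {s t : ℕ} (h : s ≤ t) (x : Abelian.Ext (ModuleCat.of R (R ⧸ a ^ s)) M j) :
    of t ((Abelian.Ext.mk₀ (powFactor a h)).comp x (zero_add j)) = of s x :=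
  Module.DirectLimit.of_f (f := extTransition a j M)

lemma exists_of_eq_zero {s : ℕ} {x : Abelian.Ext (ModuleCat.of R (R ⧸ a ^ s)) M j}
    (hx : of s x = 0) :
    ∃ t, ∃ h : s ≤ t, (Abelian.Ext.mk₀ (powFactor a h)).comp x (zero_add j) = 0 :=
  Module.DirectLimit.of.zero_exact (f := extTransition a j M) hx

/-- The universal property of the direct limit. -/
def lift {P : Type*} [AddCommGroup P] [Module R P]
    (g : ∀ t, Abelian.Ext (ModuleCat.of R (R ⧸ a ^ t)) M j →ₗ[R] P)
    (hg : ∀ s t (h : s ≤ t) x,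
      g t ((Abelian.Ext.mk₀ (powFactor a h)).comp x (zero_add j)) = g s x) : LC a j M →ₗ[R] P :=
  Module.DirectLimit.lift R ℕ _ (extTransition a j M) g hg

lemma lift_of {P : Type*} [AddCommGroup P] [Module R P]
    (g : ∀ t, Abelian.Ext (ModuleCat.of R (R ⧸ a ^ t)) M j →ₗ[R] P)
    (hg : ∀ s t (h : s ≤ t) x,
      g t ((Abelian.Ext.mk₀ (powFactor a h)).comp x (zero_add j)) = g s x) (t : ℕ)
    (x : Abelian.Ext (ModuleCat.of R (R ⧸ a ^ t)) M j) : lift g hg (of t x) = g t x :=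
  Module.DirectLimit.lift_of (f := extTransition a j M) g hg x

end LC

lemma nonempty_linearEquiv_localCohomology (j : ℕ) (M : ModuleCat.{u} R) :
    Nonempty (LC a j M ≃ₗ[R] (localCohomology a j).obj M) := by
  let I := localCohomology.idealPowersDiagram a
  let K := localCohomology.diagram I j
  let F : (ℕᵒᵖ)ᵒᵖ ⥤ ModuleCat.{u} R := K ⋙ (evaluation _ _).obj M
  let e : (localCohomology a j).obj M ≅ colimit F := colimitObjIsoColimitCompEvaluation K M
  let ε (t : ℕ) := extEquiv (ModuleCat.of R (R ⧸ a ^ t)) M j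
  have key (s t : ℕ) (h : s ≤ t) (x : Abelian.Ext (ModuleCat.of R (R ⧸ a ^ s)) M j) :
      (ε t).symm ((Abelian.Ext.mk₀ (powFactor a h)).comp x (zero_add j)) =
      (((Ext R (ModuleCat.{u} R) j).map (powFactor a h).op).app M).hom ((ε s).symm x) := by
    rw [LinearEquiv.symm_apply_eq, extEquiv_naturality, LinearEquiv.apply_symm_apply]
  let c : ModuleCat.{u} R := colimit F
  let ι (t : ℕ) : ((Ext R (ModuleCat.{u} R) j).obj
      (.op (ModuleCat.of R (R ⧸ a ^ t)))).obj M ⟶ c := colimit.ι F (.op (.op t))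
  have hι (s t : ℕ) (h : s ≤ t) :
      ((Ext R (ModuleCat.{u} R) j).map (powFactor a h).op).app M ≫ ι t = ι s :=
    colimit.w F (homOfLE h).op.op
  let g : LC a j M →ₗ[R] c :=
    LC.lift (fun t => (ι t).hom ∘ₗ (ε t).symm.toLinearMap)
      (fun s t h x => by
        have := congrArg (fun f => f.hom ((ε s).symm x)) (hι s t h)
        refine Eq.trans ?_ this
        exact congrArg (ι t).hom (key s t h x))
  have hg (t : ℕ) (x) : g (LC.of t x) = (ι t).hom ((ε t).symm x) := LC.lift_of _ _ _ _
  have : PreservesFilteredColimitsOfSize.{0, 0} (forget (ModuleCat.{u} R)) :=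
    preservesFilteredColimitsOfSize_shrink.{0, u, 0, u} _
  have : IsCofiltered ℕᵒᵖ := isCofiltered_op_of_isFiltered ℕ
  have : IsFiltered ℕᵒᵖᵒᵖ := isFiltered_op_of_isCofiltered _
  have : PreservesColimitsOfShape ℕᵒᵖᵒᵖ (forget (ModuleCat.{u} R)) :=
    PreservesFilteredColimitsOfSize.preserves_filtered_colimits _
  have hinj : Function.Injective g := by
    rw [injective_iff_map_eq_zero]
    intro x hx
    obtain ⟨t, y, rfl⟩ := LC.exists_of x
    rw [hg] at hx
    obtain ⟨k, f, hf⟩ := Concrete.colimit_rep_eq_zero R F (.op (.op t)) _ hx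
    have hle : t ≤ k.unop.unop := leOfHom f.unop.unop
    have h := key t k.unop.unop hle y
    have hf' : (((Ext R (ModuleCat.{u} R) j).map (powFactor a hle).op).app M).hom
        ((ε t).symm y) = 0 := hf
    rw [hf', LinearEquiv.symm_apply_eq, map_zero] at h
    rw [← LC.of_transition hle, h, map_zero]
  have hsurj : Function.Surjective g := by
    intro x
    obtain ⟨k, y, rfl⟩ := Concrete.colimit_exists_rep F x
    exact ⟨LC.of k.unop.unop (ε k.unop.unop y),
      (hg _ _).trans (congrArg (ι k.unop.unop).hom ((ε k.unop.unop).symm_apply_apply y))⟩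
  exact ⟨LinearEquiv.ofBijective g ⟨hinj, hsurj⟩ ≪≫ₗ e.symm.toLinearEquiv⟩

end Model

end LocCoh

namespace LocCoh

variable {R : Type u} [CommRing R] {a : Ideal R} {j : ℕ}

namespace LC

lemma exists_pow_smul_eq_zero {M : ModuleCat.{u} R} (x : LC a j M) :
    ∃ t : ℕ, ∀ r ∈ a ^ t, r • x = 0 := by
  obtain ⟨t, y, rfl⟩ := exists_of x
  refine ⟨t, fun r hr => ?_⟩
  have h0 : r • 𝟙 (ModuleCat.of R (R ⧸ a ^ t)) = 0 := by
    ext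
    change r • (Ideal.Quotient.mk (a ^ t) 1) = 0
    refine Eq.trans ?_ (Ideal.Quotient.eq_zero_iff_mem.2 hr)
    change Ideal.Quotient.mk (a ^ t) (r * 1) = _
    rw [mul_one]
  have : r • y = 0 := by
    rw [← Abelian.Ext.mk₀_id_comp y, ← Abelian.Ext.smul_comp, ← Abelian.Ext.mk₀_smul, h0]
    simp
  rw [← map_smul, this, map_zero]

variable (a j) in
/-- Functoriality of local cohomology. -/
def map {M N : ModuleCat.{u} R} (f : M ⟶ N) : LC a j M →ₗ[R] LC a j N :=
  lift (fun t => of t ∘ₗ Abelian.Ext.postcompOfLinear (Abelian.Ext.mk₀ f) R _ (add_zero j))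
    (fun s t h x => by
      change of t (((Abelian.Ext.mk₀ (powFactor a h)).comp x (zero_add j)).comp
        (Abelian.Ext.mk₀ f) (add_zero j)) = of s (x.comp (Abelian.Ext.mk₀ f) (add_zero j))
      rw [Abelian.Ext.comp_assoc_of_third_deg_zero, of_transition])

lemma map_of {M N : ModuleCat.{u} R} (f : M ⟶ N) (t : ℕ)
    (x : Abelian.Ext (ModuleCat.of R (R ⧸ a ^ t)) M j) :
    map a j f (of t x) = of t (x.comp (Abelian.Ext.mk₀ f) (add_zero j)) :=
  lift_of _ _ _ _

lemma map_comp {M N P : ModuleCat.{u} R} (f : M ⟶ N) (g : N ⟶ P) (x : LC a j M) :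
    map a j (f ≫ g) x = map a j g (map a j f x) := by
  obtain ⟨t, y, rfl⟩ := exists_of x
  simp [map_of]

lemma map_id {M : ModuleCat.{u} R} (x : LC a j M) :
    map a j (𝟙 M) x = x := by
  obtain ⟨t, y, rfl⟩ := exists_of x
  simp [map_of]

lemma map_zero_of_isZero {M N : ModuleCat.{u} R} (x : LC a j M) :
    map a j (0 : M ⟶ N) x = 0 := by
  obtain ⟨t, y, rfl⟩ := exists_of x
  simp [map_of]

variable {S : ShortComplex (ModuleCat.{u} R)} (hS : S.ShortExact)

variable (a j) in
/-- The connecting homomorphism. -/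
def δ : LC a j S.X₃ →ₗ[R] LC a (j + 1) S.X₁ :=
  lift (fun t => of t ∘ₗ Abelian.Ext.postcompOfLinear hS.extClass R _ rfl)
    (fun s t h x => by
      change of t (((Abelian.Ext.mk₀ (powFactor a h)).comp x (zero_add j)).comp
        hS.extClass rfl) = of s (x.comp hS.extClass rfl)
      rw [Abelian.Ext.comp_assoc _ _ _ (zero_add j) rfl (by lia), of_transition])

lemma δ_of (t : ℕ)
    (x : Abelian.Ext (ModuleCat.of R (R ⧸ a ^ t)) S.X₃ j) :
    δ a j hS (of t x) = of t (x.comp hS.extClass rfl) :=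
  lift_of _ _ _ _

include hS in
lemma exact_map_map : Function.Exact (map a j S.f) (map a j S.g) := by
  intro x
  constructor
  · intro hx
    obtain ⟨t, y, rfl⟩ := exists_of x
    rw [map_of] at hx
    obtain ⟨s, h, hy⟩ := exists_of_eq_zero hx
    rw [← Abelian.Ext.comp_assoc_of_third_deg_zero] at hy
    obtain ⟨z, hz⟩ := Abelian.Ext.covariant_sequence_exact₂ _ hS _ hy
    exact ⟨of s z, by rw [map_of, hz, of_transition]⟩
  · rintro ⟨y, rfl⟩
    rw [← map_comp, S.zero, map_zero_of_isZero]

lemma exact_map_δ : Function.Exact (map a j S.g) (δ a j hS) := by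
  intro x
  constructor
  · intro hx
    obtain ⟨t, y, rfl⟩ := exists_of x
    rw [δ_of] at hx
    obtain ⟨s, h, hy⟩ := exists_of_eq_zero hx
    rw [← Abelian.Ext.comp_assoc _ _ _ (zero_add j) rfl (by lia)] at hy
    obtain ⟨z, hz⟩ := Abelian.Ext.covariant_sequence_exact₃ _ hS _ rfl hy
    exact ⟨of s z, by rw [map_of, hz, of_transition]⟩
  · rintro ⟨y, rfl⟩
    obtain ⟨t, y, rfl⟩ := exists_of y
    rw [map_of, δ_of, Abelian.Ext.comp_assoc_of_second_deg_zero, hS.comp_extClass]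
    simp

lemma exact_δ_map : Function.Exact (δ a j hS) (map a (j + 1) S.f) := by
  intro x
  constructor
  · intro hx
    obtain ⟨t, y, rfl⟩ := exists_of x
    rw [map_of] at hx
    obtain ⟨s, h, hy⟩ := exists_of_eq_zero hx
    rw [← Abelian.Ext.comp_assoc_of_third_deg_zero] at hy
    obtain ⟨z, hz⟩ := Abelian.Ext.covariant_sequence_exact₁ _ hS _ hy rfl
    exact ⟨of s z, by rw [δ_of, hz, of_transition]⟩
  · rintro ⟨y, rfl⟩
    obtain ⟨t, y, rfl⟩ := exists_of y
    rw [δ_of, map_of, Abelian.Ext.comp_assoc_of_third_deg_zero, hS.extClass_comp]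
    simp

lemma subsingleton_of_injective (E : ModuleCat.{u} R) [Injective E] :
    Subsingleton (LC a (j + 1) E) := by
  refine subsingleton_of_forall_eq 0 fun x => ?_
  obtain ⟨t, y, rfl⟩ := exists_of x
  rw [Abelian.Ext.eq_zero_of_injective y, map_zero]

lemma linearEquiv₀_mk₀ {M N : ModuleCat.{u} R} (f : M ⟶ N) :
    Abelian.Ext.linearEquiv₀ (R := R) (Abelian.Ext.mk₀ f) = f :=
  (Abelian.Ext.linearEquiv₀ (R := R)).apply_symm_apply f

variable (a) in
/-- Evaluation at `1`, identifying local cohomology in degree zero with the torsion submodule. -/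
def eval (M : ModuleCat.{u} R) : LC a 0 M →ₗ[R] M :=
  lift (fun t => (LinearMap.applyₗ (R := R) (Ideal.Quotient.mk (a ^ t) 1)) ∘ₗ
      (ModuleCat.homLinearEquiv (S := R)).toLinearMap ∘ₗ
      (Abelian.Ext.linearEquiv₀ (R := R)).toLinearMap)
    (fun s t h x => by
      obtain ⟨f, rfl⟩ := (Abelian.Ext.linearEquiv₀ (R := R)).symm.surjective x
      change ((Abelian.Ext.linearEquiv₀ (R := R))
        ((Abelian.Ext.mk₀ _).comp (Abelian.Ext.mk₀ f) _)).hom _ =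
        ((Abelian.Ext.linearEquiv₀ (R := R)) (Abelian.Ext.mk₀ f)).hom _
      rw [Abelian.Ext.mk₀_comp_mk₀]
      rw [linearEquiv₀_mk₀, linearEquiv₀_mk₀]
      rfl)

lemma eval_of {M : ModuleCat.{u} R} (t : ℕ) (f : ModuleCat.of R (R ⧸ a ^ t) ⟶ M) :
    eval a M (of t (Abelian.Ext.mk₀ f)) = f.hom (Ideal.Quotient.mk (a ^ t) 1) :=
  (lift_of _ _ _ _).trans (by
    change (Abelian.Ext.linearEquiv₀ (R := R) (Abelian.Ext.mk₀ f)).hom _ = _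
    rw [linearEquiv₀_mk₀])

lemma eval_injective (M : ModuleCat.{u} R) : Function.Injective (eval a M) := by
  rw [injective_iff_map_eq_zero]
  intro x hx
  obtain ⟨t, y, rfl⟩ := exists_of x
  obtain ⟨f, rfl⟩ := Abelian.Ext.homEquiv₀.symm.surjective y
  change eval a M (of t (Abelian.Ext.mk₀ f)) = 0 at hx
  rw [eval_of] at hx
  have : f = 0 := by
    ext
    exact hx
  simp [this]

lemma exists_eval_eq_iff (M : ModuleCat.{u} R) (m : M) :
    (∃ x, eval a M x = m) ↔ ∃ t : ℕ, ∀ r ∈ a ^ t, r • m = 0 := by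
  constructor
  · rintro ⟨x, rfl⟩
    obtain ⟨t, ht⟩ := exists_pow_smul_eq_zero x
    exact ⟨t, fun r hr => by rw [← map_smul, ht r hr, map_zero]⟩
  · rintro ⟨t, ht⟩
    refine ⟨of t (Abelian.Ext.mk₀ (ModuleCat.ofHom ((a ^ t).liftQ
      (LinearMap.toSpanSingleton R M m) fun r hr => ht r hr))), ?_⟩
    rw [eval_of]
    change LinearMap.toSpanSingleton R M m 1 = m
    simp

lemma eval_map {M N : ModuleCat.{u} R} (f : M ⟶ N) (x : LC a 0 M) :
    eval a N (map a 0 f x) = f.hom (eval a M x) := by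
  obtain ⟨t, y, rfl⟩ := exists_of x
  obtain ⟨g, rfl⟩ := Abelian.Ext.homEquiv₀.symm.surjective y
  change eval a N (map a 0 f (of t (Abelian.Ext.mk₀ g))) =
    f.hom (eval a M (of t (Abelian.Ext.mk₀ g)))
  rw [map_of, Abelian.Ext.mk₀_comp_mk₀, eval_of, eval_of]
  simp

end LC

end LocCoh

/-- A module is minimax if it has a finitely generated submodule with Artinian quotient. -/
def IsMinimax (R X : Type*) [CommRing R] [AddCommGroup X] [Module R X] : Prop :=
  ∃ N : Submodule R X, N.FG ∧ IsArtinian R (X ⧸ N)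

namespace IsMinimax

variable {R : Type*} [CommRing R] {X Y Z : Type*} [AddCommGroup X] [Module R X]
  [AddCommGroup Y] [Module R Y] [AddCommGroup Z] [Module R Z]

lemma of_finite [Module.Finite R X] : IsMinimax R X :=
  ⟨⊤, Module.Finite.fg_top, inferInstance⟩

lemma of_isArtinian [IsArtinian R X] : IsMinimax R X :=
  ⟨⊥, Submodule.fg_bot, inferInstance⟩

lemma of_subsingleton [Subsingleton X] : IsMinimax R X := of_finite

lemma pi_fin (hX : IsMinimax R X) (n : ℕ) : IsMinimax R (Fin n → X) := by
  obtain ⟨A, hA, _⟩ := hX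
  refine ⟨Submodule.pi Set.univ fun _ => A, Submodule.fg_pi fun _ => hA, ?_⟩
  have e := Submodule.quotientPi (R := R) fun _ : Fin n => A
  exact isArtinian_of_injective e.toLinearMap e.injective

section Noetherian

variable [IsNoetherianRing R]

lemma of_exact {f : X →ₗ[R] Y} {g : Y →ₗ[R] Z} (hfg : Function.Exact f g)
    (hX : IsMinimax R X) (hZ : IsMinimax R Z) : IsMinimax R Y := by
  obtain ⟨A, hA, _⟩ := hX
  obtain ⟨C, hC, _⟩ := hZ
  have hCg : (C ⊓ LinearMap.range g).FG := by
    have := isNoetherian_of_fg_of_noetherian C hC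
    exact Submodule.FG.of_le hC inf_le_left
  obtain ⟨n, s, hs⟩ := Submodule.fg_iff_exists_fin_generating_family.1 hCg
  have hsr (i : Fin n) : ∃ b, g b = s i :=
    (hs ▸ Submodule.subset_span ⟨i, rfl⟩ : s i ∈ C ⊓ LinearMap.range g).2
  choose b hb using hsr
  have hmap : (Submodule.span R (Set.range b)).map g = C ⊓ LinearMap.range g := by
    rw [Submodule.map_span, ← hs, ← Set.range_comp]
    congr 2
    ext i
    simp [hb]
  refine ⟨A.map f ⊔ Submodule.span R (Set.range b),
    (hA.map f).sup (Submodule.fg_span (Set.finite_range b)), ?_⟩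
  have h1 : A ≤ (A.map f ⊔ Submodule.span R (Set.range b)).comap f := fun x hx =>
    Submodule.mem_sup_left ⟨x, hx, rfl⟩
  have h2 : A.map f ⊔ Submodule.span R (Set.range b) ≤ C.comap g := by
    refine sup_le ?_ ?_
    · rintro _ ⟨x, -, rfl⟩
      simp [hfg.apply_apply_eq_zero]
    · rw [← Submodule.map_le_iff_le_comap, hmap]
      exact inf_le_left
  refine isArtinian_of_range_eq_ker (A.mapQ _ f h1) (Submodule.mapQ _ C g h2) ?_
  ext y
  obtain ⟨y, rfl⟩ := Submodule.Quotient.mk_surjective _ y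
  simp only [LinearMap.mem_range, LinearMap.mem_ker, Submodule.mapQ_apply,
    Submodule.Quotient.mk_eq_zero]
  constructor
  · rintro ⟨x, hx⟩
    obtain ⟨x, rfl⟩ := Submodule.Quotient.mk_surjective _ x
    rw [Submodule.mapQ_apply, Submodule.Quotient.eq] at hx
    have := h2 hx
    simpa [hfg.apply_apply_eq_zero] using this
  · intro hy
    obtain ⟨z, hz, hzy⟩ : g y ∈ (Submodule.span R (Set.range b)).map g := by
      rw [hmap]
      exact ⟨hy, y, rfl⟩
    obtain ⟨x, hx⟩ := (hfg (y - z)).1 (by rw [map_sub, hzy, sub_self])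
    refine ⟨Submodule.Quotient.mk x, ?_⟩
    rw [Submodule.mapQ_apply, Submodule.Quotient.eq, hx, sub_sub_cancel_left]
    exact neg_mem (Submodule.mem_sup_right hz)

lemma of_injective (f : X →ₗ[R] Y) (hf : Function.Injective f) (hY : IsMinimax R Y) :
    IsMinimax R X :=
  of_exact (f := (0 : PUnit →ₗ[R] X)) (g := f)
    ((LinearMap.exact_zero_iff_injective _ _).2 hf) of_subsingleton hY

lemma of_surjective (f : X →ₗ[R] Y) (hf : Function.Surjective f) (hX : IsMinimax R X) :
    IsMinimax R Y :=
  of_exact (f := f) (g := (0 : Y →ₗ[R] PUnit))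
    ((LinearMap.exact_zero_iff_surjective _ _).2 hf) hX of_subsingleton

lemma of_le {P Q : Submodule R X} (h : P ≤ Q) (hQ : IsMinimax R Q) : IsMinimax R P :=
  hQ.of_injective (Submodule.inclusion h) (Submodule.inclusion_injective h)

/-- If `J • P` is contained in a minimax submodule, then `P` is minimax as soon as its elements
killed by `J` form a minimax module. -/
lemma of_smul_mem {J : Ideal R} {P K : Submodule R X} (h : ∀ r ∈ J, ∀ x ∈ P, r • x ∈ K)
    (hK : IsMinimax R K)
    (hT : IsMinimax R (P ⊓ Submodule.torsionBySet R X J : Submodule R X)) : IsMinimax R P := by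
  obtain ⟨n, s, hs⟩ := Submodule.fg_iff_exists_fin_generating_family.1
    ((isNoetherianRing_iff_ideal_fg R).1 inferInstance J)
  have hsJ (i : Fin n) : s i ∈ J := hs ▸ Submodule.subset_span ⟨i, rfl⟩
  let φ : P →ₗ[R] (Fin n → K) := LinearMap.pi fun i =>
    ((s i) • P.subtype).codRestrict K fun x => h _ (hsJ i) _ x.2
  refine of_exact (f := Submodule.inclusion inf_le_left) (g := φ) ?_ hT (hK.pi_fin n)
  intro x
  constructor
  · intro hx
    have hx' (i : Fin n) : s i • (x : X) = 0 := congrArg (fun y => (y i : X)) hx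
    refine ⟨⟨x, x.2, ?_⟩, rfl⟩
    rw [SetLike.mem_coe, Submodule.mem_torsionBySet_iff]
    rintro ⟨r, hr'⟩
    have hr : r ∈ Submodule.span R (Set.range s) := hs ▸ hr'
    change r • (x : X) = 0
    clear hr'
    induction hr using Submodule.span_induction with
    | mem r hr => obtain ⟨i, rfl⟩ := hr; exact hx' i
    | zero => exact zero_smul _ _
    | add r r' _ _ h h' => rw [add_smul, h, h', add_zero]
    | smul c r _ h => rw [smul_assoc, h, smul_zero]
  · rintro ⟨y, rfl⟩
    ext i
    exact (Submodule.mem_torsionBySet_iff _ _).1 y.2.2 ⟨s i, hsJ i⟩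

end Noetherian

/-- `Ext` from a finitely generated module into a minimax module is minimax. -/
lemma ext {R : Type u} [CommRing R] [IsNoetherianRing R] (N A : ModuleCat.{u} R)
    [Module.Finite R N] (hA : IsMinimax R A) (l : ℕ) : IsMinimax R (Abelian.Ext N A l) := by
  induction l generalizing N with
  | zero =>
    obtain ⟨n, f, hf⟩ := Module.Finite.exists_fin' R N
    refine (hA.pi_fin n).of_injective
      ((LinearMap.pi fun i => LinearMap.applyₗ (f (Pi.single i 1))) ∘ₗ
      (Abelian.Ext.linearEquiv₀.trans ModuleCat.homLinearEquiv).toLinearMap) ?_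
    rw [LinearMap.coe_comp]
    refine Function.Injective.comp ?_ (LinearEquiv.injective _)
    intro g h hgh
    have : g ∘ₗ f = h ∘ₗ f := by
      refine LinearMap.pi_ext' fun i => LinearMap.ext_ring ?_
      exact congrFun hgh i
    ext x
    obtain ⟨y, rfl⟩ := hf x
    exact LinearMap.congr_fun this y
  | succ n ih =>
    obtain ⟨P, _, _, _, _, f, hf⟩ := Module.exists_finite_presentation R N
    let exac := LinearMap.shortExact_shortComplexKer hf
    exact (ih _).of_surjective (exac.extClass.precompOfLinear R A (add_comm 1 n))
      (precomp_extClass_surjective_of_projective_X₂ A exac n)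

end IsMinimax

namespace LocCoh

lemma shortExact_moduleCatMk {R : Type u} [CommRing R] {A B C : Type u} [AddCommGroup A]
    [Module R A] [AddCommGroup B] [Module R B] [AddCommGroup C] [Module R C] {f : A →ₗ[R] B}
    {g : B →ₗ[R] C} (hf : Function.Injective f) (hfg : Function.Exact f g)
    (hg : Function.Surjective g) :
    (ShortComplex.mk (X₁ := ModuleCat.of R A) (X₂ := ModuleCat.of R B) (X₃ := ModuleCat.of R C)
      (ModuleCat.ofHom f) (ModuleCat.ofHom g)
      (ModuleCat.hom_ext hfg.linearMap_comp_eq_zero)).ShortExact where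
  exact := (ShortComplex.moduleCat_exact_iff _).2 fun x hx => (hfg x).1 hx
  mono_f := (ModuleCat.mono_iff_injective _).2 hf
  epi_g := (ModuleCat.epi_iff_surjective _).2 hg

section Unbundled

variable {R : Type u} [CommRing R] (a : Ideal R) (j : ℕ)

/-- Local cohomology of an unbundled module. -/
abbrev H (M : Type u) [AddCommGroup M] [Module R M] : Type u := LC a j (ModuleCat.of R M)

variable {A B C : Type u} [AddCommGroup A] [Module R A] [AddCommGroup B] [Module R B]
  [AddCommGroup C] [Module R C]

/-- Functoriality of local cohomology. -/
def H.map (f : A →ₗ[R] B) : H a j A →ₗ[R] H a j B := LC.map a j (ModuleCat.ofHom f)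

variable (A) in
/-- The identification of `H⁰` with a submodule. -/
def H.eval : H a 0 A →ₗ[R] A := LC.eval a (ModuleCat.of R A)

variable {a j}

lemma H.map_comp (f : A →ₗ[R] B) (g : B →ₗ[R] C) (x : H a j A) :
    H.map a j (g ∘ₗ f) x = H.map a j g (H.map a j f x) := LC.map_comp _ _ _

lemma H.map_id (x : H a j A) : H.map a j (LinearMap.id : A →ₗ[R] A) x = x := LC.map_id _

lemma H.map_zero (x : H a j A) : H.map a j (0 : A →ₗ[R] B) x = 0 := LC.map_zero_of_isZero _

lemma H.eval_injective : Function.Injective (H.eval a A) := LC.eval_injective _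

lemma H.eval_map (f : A →ₗ[R] B) (x : H a 0 A) :
    H.eval a B (H.map a 0 f x) = f (H.eval a A x) := LC.eval_map _ _

lemma H.subsingleton_of_injective [Module.Injective R A] : Subsingleton (H a (j + 1) A) :=
  have : Injective (ModuleCat.of R A) := Module.injective_object_of_injective_module R A
  LC.subsingleton_of_injective _

lemma H.subsingleton [Subsingleton A] : Subsingleton (H a j A) := by
  refine subsingleton_of_forall_eq 0 fun x => ?_
  rw [← H.map_id x, Subsingleton.elim (LinearMap.id : A →ₗ[R] A) 0, H.map_zero]

variable {f : A →ₗ[R] B} {g : B →ₗ[R] C}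

/-- The connecting homomorphism. -/
def H.δ (a : Ideal R) (j : ℕ) (hf : Function.Injective f) (hfg : Function.Exact f g)
    (hg : Function.Surjective g) : H a j C →ₗ[R] H a (j + 1) A :=
  have hS := shortExact_moduleCatMk hf hfg hg
  LC.δ (S := ShortComplex.mk (X₁ := ModuleCat.of R A) (X₂ := ModuleCat.of R B)
    (X₃ := ModuleCat.of R C) (ModuleCat.ofHom f) (ModuleCat.ofHom g)
      (ModuleCat.hom_ext hfg.linearMap_comp_eq_zero)) a j hS

variable (hf : Function.Injective f) (hfg : Function.Exact f g) (hg : Function.Surjective g)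

include hf hfg hg in
lemma H.exact_map_map : Function.Exact (H.map a j f) (H.map a j g) := by
  have := LC.exact_map_map (a := a) (j := j) (shortExact_moduleCatMk hf hfg hg)
  exact this

lemma H.exact_map_δ : Function.Exact (H.map a j g) (H.δ a j hf hfg hg) := by
  have := LC.exact_map_δ (a := a) (j := j) (shortExact_moduleCatMk hf hfg hg)
  exact this

lemma H.exact_δ_map : Function.Exact (H.δ a j hf hfg hg) (H.map a (j + 1) f) := by
  have := LC.exact_δ_map (a := a) (j := j) (shortExact_moduleCatMk hf hfg hg)
  exact this

end Unbundled

section PowTorsion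

variable {R : Type*} [CommRing R] (a : Ideal R) (M : Type*) [AddCommGroup M] [Module R M]

/-- The submodule of elements killed by a power of `a`. -/
def powTorsion : Submodule R M where
  carrier := {m | ∃ t : ℕ, ∀ r ∈ a ^ t, r • m = 0}
  zero_mem' := ⟨0, by simp⟩
  add_mem' := by
    rintro x y ⟨s, hs⟩ ⟨t, ht⟩
    refine ⟨max s t, fun r hr => ?_⟩
    rw [smul_add, hs r (Ideal.pow_le_pow_right (le_max_left _ _) hr),
      ht r (Ideal.pow_le_pow_right (le_max_right _ _) hr), add_zero]
  smul_mem' := by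
    rintro c x ⟨s, hs⟩
    exact ⟨s, fun r hr => by rw [smul_comm, hs r hr, smul_zero]⟩

variable {a M}

lemma exists_pow_smul_eq_zero_of_fg {N : Submodule R M} (hN : N.FG) (h : N ≤ powTorsion a M) :
    ∃ t : ℕ, ∀ r ∈ a ^ t, ∀ x ∈ N, r • x = 0 := by
  induction N, hN using Submodule.fg_induction with
  | singleton x =>
    obtain ⟨t, ht⟩ := h (Submodule.mem_span_singleton_self x)
    refine ⟨t, fun r hr y hy => ?_⟩
    obtain ⟨c, rfl⟩ := Submodule.mem_span_singleton.1 hy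
    rw [smul_comm, ht r hr, smul_zero]
  | sup N₁ N₂ _ _ h₁ h₂ =>
    obtain ⟨s, hs⟩ := h₁ (le_sup_left.trans h)
    obtain ⟨t, ht⟩ := h₂ (le_sup_right.trans h)
    refine ⟨max s t, fun r hr y hy => ?_⟩
    obtain ⟨y₁, hy₁, y₂, hy₂, rfl⟩ := Submodule.mem_sup.1 hy
    rw [smul_add, hs r (Ideal.pow_le_pow_right (le_max_left _ _) hr) _ hy₁,
      ht r (Ideal.pow_le_pow_right (le_max_right _ _) hr) _ hy₂, add_zero]

lemma mem_powTorsion_of_pow_smul_mem [IsNoetherianRing R] {m : M} {t : ℕ}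
    (h : ∀ r ∈ a ^ t, r • m ∈ powTorsion a M) : m ∈ powTorsion a M := by
  obtain ⟨s, hs⟩ := exists_pow_smul_eq_zero_of_fg
    (N := Submodule.map (LinearMap.toSpanSingleton R M m) (a ^ t))
    ((IsNoetherian.noetherian (R := R) (M := R) (a ^ t)).map _) (by
      rintro _ ⟨r, hr, rfl⟩
      simpa using h r hr)
  refine ⟨s + t, fun r hr => ?_⟩
  rw [pow_add] at hr
  refine Submodule.mul_induction_on (C := fun r => r • m = 0) hr (fun x hx y hy => ?_)
    fun x y h h' => by rw [add_smul, h, h', add_zero]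
  rw [mul_smul]
  exact hs x hx _ ⟨y, hy, by simp⟩

lemma powTorsion_quotient [IsNoetherianRing R] : powTorsion a (M ⧸ powTorsion a M) = ⊥ := by
  rw [eq_bot_iff]
  intro x hx
  obtain ⟨m, rfl⟩ := Submodule.Quotient.mk_surjective _ x
  obtain ⟨t, ht⟩ := hx
  rw [Submodule.mem_bot, Submodule.Quotient.mk_eq_zero]
  refine mem_powTorsion_of_pow_smul_mem (t := t) fun r hr => ?_
  rw [← Submodule.Quotient.mk_eq_zero, Submodule.Quotient.mk_smul, ht r hr]

lemma powTorsion_powTorsion : powTorsion a (powTorsion a M) = ⊤ := by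
  rw [eq_top_iff]
  rintro ⟨x, t, ht⟩ -
  exact ⟨t, fun r hr => Subtype.ext (ht r hr)⟩

lemma powTorsion_quotient_eq_top (h : powTorsion a M = ⊤) (N : Submodule R M) :
    powTorsion a (M ⧸ N) = ⊤ := by
  rw [eq_top_iff]
  intro x _
  obtain ⟨m, rfl⟩ := Submodule.Quotient.mk_surjective _ x
  obtain ⟨t, ht⟩ := (h ▸ Submodule.mem_top : m ∈ powTorsion a M)
  exact ⟨t, fun r hr => by rw [← Submodule.Quotient.mk_smul, ht r hr, Submodule.Quotient.mk_zero]⟩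

variable {N : Type*} [AddCommGroup N] [Module R N]

lemma map_mem_powTorsion (f : M →ₗ[R] N) {m : M} (h : m ∈ powTorsion a M) :
    f m ∈ powTorsion a N := by
  obtain ⟨t, ht⟩ := h
  exact ⟨t, fun r hr => by rw [← map_smul, ht r hr, map_zero]⟩

lemma mem_powTorsion_of_injective (f : M →ₗ[R] N) (hf : Function.Injective f) {m : M}
    (h : f m ∈ powTorsion a N) : m ∈ powTorsion a M := by
  obtain ⟨t, ht⟩ := h
  exact ⟨t, fun r hr => hf (by rw [map_smul, ht r hr, map_zero])⟩

end PowTorsion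

section Injective

variable {R : Type u} [CommRing R] [IsNoetherianRing R] {a : Ideal R}

lemma injective_powTorsion (E : Type u) [AddCommGroup E] [Module R E] [Module.Injective R E] :
    Module.Injective R (powTorsion a E) := by
  apply Module.Baer.injective
  intro I f
  obtain ⟨t, ht⟩ := exists_pow_smul_eq_zero_of_fg (a := a) (N := LinearMap.range f)
    (Submodule.fg_range f) (by rw [powTorsion_powTorsion]; exact le_top)
  obtain ⟨k, hk⟩ := Ideal.exists_pow_inf_eq_pow_smul a (I : Submodule R R)
  have hker (r : R) (hrI : r ∈ I) (hr : r ∈ a ^ (k + t)) : f ⟨r, hrI⟩ = 0 := by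
    have h1 : r ∈ a ^ (k + t - k) • (a ^ k • ⊤ ⊓ (I : Submodule R R)) := by
      rw [← hk _ (Nat.le_add_right k t)]
      exact ⟨by simpa using hr, hrI⟩
    rw [Nat.add_sub_cancel_left] at h1
    have h2 : r ∈ (a ^ t • ⊤ : Submodule R I).map I.subtype := by
      rw [Submodule.map_smul'', Submodule.map_top, Submodule.range_subtype]
      exact Submodule.smul_mono le_rfl inf_le_right h1
    obtain ⟨y, hy, rfl⟩ := h2
    change f y = 0
    refine Submodule.smul_induction_on (p := fun y => f y = 0) hy (fun c hc n _ => ?_)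
      fun x y h h' => by rw [map_add, h, h', add_zero]
    rw [map_smul, ht c hc _ ⟨n, rfl⟩]
  let q : I →ₗ[R] (R ⧸ a ^ (k + t)) := (a ^ (k + t)).mkQ ∘ₗ I.subtype
  let f' : (I ⧸ LinearMap.ker q) →ₗ[R] E := (LinearMap.ker q).liftQ ((powTorsion a E).subtype ∘ₗ f)
    (fun x hx => by
      have hx' : (x : R) ∈ a ^ (k + t) := (Submodule.Quotient.mk_eq_zero _).1 hx
      simp [hker x x.2 hx'])
  obtain ⟨h, hh⟩ := Module.Injective.out ((LinearMap.ker q).liftQ q le_rfl)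
    (LinearMap.ker_eq_bot.1 (Submodule.ker_liftQ_eq_bot' _ _ rfl)) f'
  have he : h ((a ^ (k + t)).mkQ 1) ∈ powTorsion a E := by
    refine ⟨k + t, fun r hr => ?_⟩
    rw [← map_smul, ← map_smul, smul_eq_mul, mul_one, Submodule.mkQ_apply,
      (Submodule.Quotient.mk_eq_zero _).2 hr, map_zero]
  refine ⟨LinearMap.toSpanSingleton R _ ⟨_, he⟩, fun r hr => Subtype.ext ?_⟩
  have := hh (Submodule.Quotient.mk ⟨r, hr⟩)
  change h ((a ^ (k + t)).mkQ r) = f ⟨r, hr⟩ at this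
  rw [← this]
  change r • h ((a ^ (k + t)).mkQ 1) = _
  rw [← map_smul, ← map_smul, smul_eq_mul, mul_one]

omit [IsNoetherianRing R] in
lemma injective_quotient_of_injective (E : Type u) [AddCommGroup E] [Module R E]
    [Module.Injective R E] (G : Submodule R E) [Module.Injective R G] :
    Module.Injective R (E ⧸ G) := by
  obtain ⟨r, hr⟩ := Module.Injective.out G.subtype G.injective_subtype LinearMap.id
  let s : (E ⧸ G) →ₗ[R] E := G.liftQ (LinearMap.id - G.subtype ∘ₗ r) (fun x hx => by
    have := hr ⟨x, hx⟩
    change r x = _ at this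
    simp [this])
  have hs (x : E ⧸ G) : G.mkQ (s x) = x := by
    obtain ⟨x, rfl⟩ := G.mkQ_surjective x
    change G.mkQ (x - r x) = _
    simp
  refine ⟨fun X Y _ _ _ _ f hf g => ?_⟩
  obtain ⟨h, hh⟩ := Module.Injective.out f hf (s ∘ₗ g)
  exact ⟨G.mkQ ∘ₗ h, fun x => by simpa [hs] using congr_arg G.mkQ (hh x)⟩

omit [IsNoetherianRing R] in
lemma exists_injective_hull (M : Type u) [AddCommGroup M] [Module R M] :
    ∃ (E : ModuleCat.{u} R) (ι : M →ₗ[R] E), Module.Injective R E ∧ Function.Injective ι := by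
  obtain ⟨⟨E, hE, ι, hι⟩⟩ := EnoughInjectives.presentation (ModuleCat.of R M)
  have hE' : Injective (ModuleCat.of R E) := hE
  exact ⟨E, ι.hom, Module.injective_module_of_injective_object R E,
    (ModuleCat.mono_iff_injective _).1 hι⟩

omit [IsNoetherianRing R] in
lemma range_eval (M : Type u) [AddCommGroup M] [Module R M] :
    LinearMap.range (H.eval a M) = powTorsion a M := by
  ext m
  exact LC.exists_eval_eq_iff (a := a) (ModuleCat.of R M) m

lemma subsingleton_of_powTorsion_eq_top (j : ℕ) (T : Type u) [AddCommGroup T] [Module R T]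
    (hT : powTorsion a T = ⊤) : Subsingleton (H a (j + 1) T) := by
  induction j using Nat.strong_induction_on generalizing T with
  | h j ih =>
    obtain ⟨E, ι, hE, hι⟩ := exists_injective_hull (R := R) T
    have hG := injective_powTorsion (a := a) E
    let f : T →ₗ[R] powTorsion a E :=
      ι.codRestrict _ fun x => map_mem_powTorsion ι (hT ▸ Submodule.mem_top)
    have hf : Function.Injective f := fun x y h => hι (congr_arg Subtype.val h)
    have hfg := LinearMap.exact_map_mkQ_range f
    have hg := (LinearMap.range f).mkQ_surjective
    refine subsingleton_of_forall_eq 0 fun x => ?_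
    have := H.subsingleton_of_injective (a := a) (j := j) (A := powTorsion a E)
    obtain ⟨y, rfl⟩ := (H.exact_δ_map hf hfg hg x).1 (Subsingleton.elim _ _)
    refine (H.exact_map_δ hf hfg hg y).2 ?_
    cases j with
    | zero =>
      obtain ⟨e, he⟩ := (LinearMap.range f).mkQ_surjective (H.eval a _ y)
      obtain ⟨x, hx⟩ : e ∈ LinearMap.range (H.eval a (powTorsion a E)) := by
        rw [range_eval, powTorsion_powTorsion]
        exact Submodule.mem_top
      refine ⟨x, H.eval_injective ?_⟩
      rw [H.eval_map, hx, he]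
    | succ j =>
      have := ih j (Nat.lt_succ_self j) (powTorsion a E ⧸ LinearMap.range f)
        (powTorsion_quotient_eq_top powTorsion_powTorsion _)
      exact ⟨0, Subsingleton.elim _ _⟩

end Injective

section Torsion

variable {R : Type u} [CommRing R] {a : Ideal R}

variable {A B C : Type u} [AddCommGroup A] [Module R A] [AddCommGroup B] [Module R B]
  [AddCommGroup C] [Module R C]

lemma exists_ext_exact {f : A →ₗ[R] B} {g : B →ₗ[R] C} (hf : Function.Injective f)
    (hfg : Function.Exact f g) (hg : Function.Surjective g) (N : ModuleCat.{u} R) (l : ℕ) :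
    ∃ (φ : Abelian.Ext N (ModuleCat.of R B) l →ₗ[R] Abelian.Ext N (ModuleCat.of R C) l)
      (ψ : Abelian.Ext N (ModuleCat.of R C) l →ₗ[R] Abelian.Ext N (ModuleCat.of R A) (l + 1)),
      Function.Exact φ ψ := by
  have hS := shortExact_moduleCatMk hf hfg hg
  refine ⟨Abelian.Ext.postcompOfLinear (Abelian.Ext.mk₀ (ModuleCat.ofHom g)) R _ (add_zero l),
    Abelian.Ext.postcompOfLinear hS.extClass R _ rfl, fun x => ⟨fun hx => ?_, ?_⟩⟩
  · obtain ⟨y, hy⟩ := Abelian.Ext.covariant_sequence_exact₃ N hS x rfl hx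
    exact ⟨y, hy⟩
  · rintro ⟨y, rfl⟩
    change (y.comp (Abelian.Ext.mk₀ (ModuleCat.ofHom g)) (add_zero l)).comp hS.extClass rfl = 0
    have h := hS.comp_extClass
    rw [Abelian.Ext.comp_assoc_of_second_deg_zero]
    exact (congr_arg (fun z => y.comp z rfl) h).trans (Abelian.Ext.comp_zero _ _ _ _ _)

variable {X Y : Type*} [AddCommGroup X] [Module R X] [AddCommGroup Y] [Module R Y]

lemma isMinimax_torsionBySet_of_injective [IsNoetherianRing R] (f : X →ₗ[R] Y)
    (hf : Function.Injective f) {s : Set R} (h : IsMinimax R (Submodule.torsionBySet R Y s)) :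
    IsMinimax R (Submodule.torsionBySet R X s) := by
  have hmem (x : Submodule.torsionBySet R X s) : f x ∈ Submodule.torsionBySet R Y s := by
    rw [Submodule.mem_torsionBySet_iff]
    intro c
    rw [← map_smul, (Submodule.mem_torsionBySet_iff s _).1 x.2 c, map_zero]
  exact .of_injective ((f ∘ₗ Submodule.subtype _).codRestrict _ hmem)
    (fun x y hxy => Subtype.ext (hf (congr_arg Subtype.val hxy))) h

variable (a) in
lemma exists_injective_hull_of_powTorsion_eq_bot [IsNoetherianRing R] (M : Type u)
    [AddCommGroup M] [Module R M] (hM : powTorsion a M = ⊥) :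
    ∃ (E : ModuleCat.{u} R) (ι : M →ₗ[R] E), Module.Injective R E ∧ Function.Injective ι ∧
      powTorsion a E = ⊥ := by
  obtain ⟨E, ι, hE, hι⟩ := exists_injective_hull (R := R) M
  have hG := injective_powTorsion (a := a) E
  refine ⟨ModuleCat.of R (E ⧸ powTorsion a E), (powTorsion a E).mkQ ∘ₗ ι,
    injective_quotient_of_injective _ _, ?_, powTorsion_quotient⟩
  rw [injective_iff_map_eq_zero]
  intro m hm
  have h : m ∈ powTorsion a M :=
    mem_powTorsion_of_injective ι hι ((Submodule.Quotient.mk_eq_zero _).1 hm)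
  rwa [hM] at h

lemma subsingleton_of_powTorsion_eq_bot (h : powTorsion a A = ⊥) : Subsingleton (H a 0 A) := by
  refine subsingleton_of_forall_eq 0 fun x => H.eval_injective ?_
  rw [map_zero, ← Submodule.mem_bot R, ← h, ← range_eval]
  exact ⟨x, rfl⟩

lemma subsingleton_ext_of_powTorsion_eq_bot (h : powTorsion a A = ⊥) :
    Subsingleton (Abelian.Ext (ModuleCat.of R (R ⧸ a ^ 1)) (ModuleCat.of R A) 0) := by
  refine subsingleton_of_forall_eq 0 fun x => ?_
  obtain ⟨g, rfl⟩ := Abelian.Ext.homEquiv₀.symm.surjective x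
  change Abelian.Ext.mk₀ g = 0
  suffices g = 0 by rw [this, Abelian.Ext.mk₀_zero]
  ext
  change g.hom (Ideal.Quotient.mk (a ^ 1) 1) = 0
  rw [← Submodule.mem_bot R, ← h]
  refine ⟨1, fun r hr => ?_⟩
  rw [← map_smul, ← map_zero g.hom]
  congr 1
  change Ideal.Quotient.mk _ (r * 1) = 0
  rwa [mul_one, Ideal.Quotient.eq_zero_iff_mem]

variable [IsNoetherianRing R]

lemma isMinimax_torsionBySet_zero (M : Type u) [AddCommGroup M] [Module R M]
    (h : IsMinimax R (Abelian.Ext (ModuleCat.of R (R ⧸ a ^ 1)) (ModuleCat.of R M) 0)) :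
    IsMinimax R (Submodule.torsionBySet R (H a 0 M) a) := by
  refine IsMinimax.of_le (Q := LinearMap.range (LC.of (a := a) (j := 0) 1)) (fun x hx => ?_)
    (.of_surjective _ (LC.of (a := a) (j := 0) 1).surjective_rangeRestrict h)
  rw [Submodule.mem_torsionBySet_iff] at hx
  let g : (R ⧸ a ^ 1) →ₗ[R] M := (a ^ 1).liftQ (LinearMap.toSpanSingleton R M (H.eval a M x))
    fun r hr => by
      rw [pow_one] at hr
      have := congr_arg (H.eval a M) (hx ⟨r, hr⟩)
      rw [map_zero, map_smul] at this
      exact this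
  refine ⟨Abelian.Ext.mk₀ (ModuleCat.ofHom g), H.eval_injective ?_⟩
  refine (LC.eval_of _ _).trans ?_
  change (1 : R) • H.eval a M x = _
  rw [one_smul]

theorem isMinimax_torsionBySet (i : ℕ) (M : Type u) [AddCommGroup M] [Module R M]
    (hext : ∀ l ≤ i,
      IsMinimax R (Abelian.Ext (ModuleCat.of R (R ⧸ a ^ 1)) (ModuleCat.of R M) l))
    (hH : ∀ j < i, IsMinimax R (H a j M)) :
    IsMinimax R (Submodule.torsionBySet R (H a i M) a) := by
  induction i generalizing M with
  | zero => exact isMinimax_torsionBySet_zero M (hext 0 le_rfl)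
  | succ i ih =>
    have hΓ : IsMinimax R (powTorsion a M) := by
      rw [← range_eval]
      exact .of_surjective _ (LinearMap.surjective_rangeRestrict _) (hH 0 i.succ_pos)
    have hf := (powTorsion a M).injective_subtype
    have hfg := LinearMap.exact_subtype_mkQ (powTorsion a M)
    have hg := (powTorsion a M).mkQ_surjective
    have hbij (j : ℕ) : Function.Bijective (H.map a (j + 1) (powTorsion a M).mkQ) := by
      have h (k : ℕ) := subsingleton_of_powTorsion_eq_top (a := a) k (powTorsion a M)
        powTorsion_powTorsion
      constructor
      · rw [injective_iff_map_eq_zero]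
        intro x hx
        obtain ⟨y, rfl⟩ := (H.exact_map_map hf hfg hg x).1 hx
        rw [Subsingleton.elim y 0, map_zero]
      · intro x
        exact (H.exact_map_δ hf hfg hg x).1 (Subsingleton.elim _ _)
    obtain ⟨E, ι, hE, hι, hE'⟩ := exists_injective_hull_of_powTorsion_eq_bot a
      (M ⧸ powTorsion a M) powTorsion_quotient
    have hg' := (LinearMap.range ι).mkQ_surjective
    have hfg' := LinearMap.exact_map_mkQ_range ι
    have hHE (j : ℕ) : Subsingleton (H a j E) := by
      cases j with
      | zero => exact subsingleton_of_powTorsion_eq_bot hE'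
      | succ j => exact H.subsingleton_of_injective
    have hδ (j : ℕ) : Function.Bijective (H.δ a j hι hfg' hg') := by
      constructor
      · rw [injective_iff_map_eq_zero]
        intro x hx
        obtain ⟨y, rfl⟩ := (H.exact_map_δ hι hfg' hg' x).1 hx
        rw [Subsingleton.elim y 0, map_zero]
      · intro x
        exact (H.exact_δ_map hι hfg' hg' x).1 (Subsingleton.elim _ _)
    have key := ih (E ⧸ LinearMap.range ι) (fun l hl => ?_) fun j hj => ?_
    · refine isMinimax_torsionBySet_of_injective
        ((LinearEquiv.ofBijective _ (hδ i)).symm.toLinearMap ∘ₗ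
          H.map a (i + 1) (powTorsion a M).mkQ)
        ?_ key
      exact (LinearEquiv.ofBijective _ (hδ i)).symm.injective.comp (hbij i).1
    · obtain ⟨φ, ψ, h⟩ := exists_ext_exact hι hfg' hg' (ModuleCat.of R (R ⧸ a ^ 1)) l
      have : Subsingleton (Abelian.Ext (ModuleCat.of R (R ⧸ a ^ 1)) (ModuleCat.of R E) l) := by
        cases l with
        | zero => exact subsingleton_ext_of_powTorsion_eq_bot hE'
        | succ l =>
          have : Injective (ModuleCat.of R E) := Module.injective_object_of_injective_module R E
          exact subsingleton_of_forall_eq 0 fun x => Abelian.Ext.eq_zero_of_injective x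
      refine IsMinimax.of_exact h .of_subsingleton ?_
      obtain ⟨φ, ψ, h⟩ := exists_ext_exact hf hfg hg (ModuleCat.of R (R ⧸ a ^ 1)) (l + 1)
      exact IsMinimax.of_exact h (hext _ (Nat.succ_le_succ hl)) (.ext _ _ hΓ _)
    · exact IsMinimax.of_injective (H.δ a j hι hfg' hg') (hδ j).1
        (.of_surjective (H.map a (j + 1) (powTorsion a M).mkQ)
          (hbij j).2 (hH _ (Nat.succ_lt_succ hj)))

end Torsion

section IsLoc

variable {R : Type*} [CommRing R] (S : Submonoid R) {A : Type*} [CommRing A] [Algebra R A]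

/-- A semilinear map that becomes an isomorphism after localizing the source. -/
structure IsLoc {X Y : Type*} [AddCommGroup X] [Module R X] [AddCommGroup Y] [Module A Y]
    (f : X →ₛₗ[algebraMap R A] Y) : Prop where
  exists_smul_eq_zero : ∀ x, f x = 0 → ∃ s ∈ S, s • x = 0
  exists_smul_eq : ∀ y, ∃ s ∈ S, ∃ x, algebraMap R A s • y = f x

variable {S}

lemma IsLoc.of_linearEquiv {X Y X' Y' : Type*} [AddCommGroup X] [Module R X] [AddCommGroup Y]
    [Module A Y] [AddCommGroup X'] [Module R X'] [AddCommGroup Y'] [Module A Y']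
    {f : X →ₛₗ[algebraMap R A] Y} (hf : IsLoc S f) (e : X' ≃ₗ[R] X) (e' : Y ≃ₗ[A] Y') :
    IsLoc S ((e'.toLinearMap.comp f).comp e.toLinearMap) where
  exists_smul_eq_zero x hx := by
    obtain ⟨s, hs, h⟩ := hf.exists_smul_eq_zero (e x) (e'.injective (hx.trans (map_zero e').symm))
    exact ⟨s, hs, e.injective (by rw [map_smul, h, map_zero])⟩
  exists_smul_eq y := by
    obtain ⟨s, hs, x, h⟩ := hf.exists_smul_eq (e'.symm y)
    exact ⟨s, hs, e.symm x, e'.symm.injective (by simp [h])⟩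

/-- Localization commutes with cokernels. -/
lemma IsLoc.exists_of_exact {X Y Z X' Y' Z' : Type*} [AddCommGroup X] [Module R X]
    [AddCommGroup Y] [Module R Y] [AddCommGroup Z] [Module R Z] [AddCommGroup X'] [Module A X']
    [AddCommGroup Y'] [Module A Y'] [AddCommGroup Z'] [Module A Z']
    {u : X →ₗ[R] Y} {v : Y →ₗ[R] Z} {u' : X' →ₗ[A] Y'} {v' : Y' →ₗ[A] Z'}
    (h : Function.Exact u v) (hv : Function.Surjective v)
    (h' : Function.Exact u' v') (hv' : Function.Surjective v')
    {α : X →ₛₗ[algebraMap R A] X'} {β : Y →ₛₗ[algebraMap R A] Y'}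
    (hα : IsLoc S α) (hβ : IsLoc S β) (hαβ : ∀ x, β (u x) = u' (α x)) :
    ∃ γ : Z →ₛₗ[algebraMap R A] Z', IsLoc S γ := by
  let e := v.quotKerEquivOfSurjective hv
  let γ₀ : (Y ⧸ LinearMap.ker v) →ₛₗ[algebraMap R A] Z' :=
    (LinearMap.ker v).liftQ (v'.comp β) fun y hy => by
      obtain ⟨x, rfl⟩ := (h y).1 hy
      exact (h' _).2 ⟨α x, (hαβ x).symm⟩
  let γ : Z →ₛₗ[algebraMap R A] Z' := γ₀.comp e.symm.toLinearMap
  have hγ (y : Y) : γ (v y) = v' (β y) := by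
    have : e.symm (v y) = Submodule.Quotient.mk y :=
      e.symm_apply_eq.2 rfl
    change γ₀ (e.symm (v y)) = _
    rw [this]
    rfl
  refine ⟨γ, fun z hz => ?_, fun z => ?_⟩
  · obtain ⟨y, rfl⟩ := hv z
    rw [hγ] at hz
    obtain ⟨x', hx'⟩ := (h' _).1 hz
    obtain ⟨s, hs, x, hx⟩ := hα.exists_smul_eq x'
    obtain ⟨t, ht, h0⟩ := hβ.exists_smul_eq_zero (s • y - u x) (by
      rw [map_sub, hαβ, ← hx, map_smulₛₗ β, map_smul u', hx', sub_self])
    refine ⟨t * s, S.mul_mem ht hs, ?_⟩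
    have := congr_arg v h0
    rwa [map_smul, map_sub, map_smul, map_zero, (h _).2 ⟨x, rfl⟩, sub_zero, smul_smul] at this
  · obtain ⟨y', rfl⟩ := hv' z
    obtain ⟨s, hs, y, hy⟩ := hβ.exists_smul_eq y'
    exact ⟨s, hs, v y, by rw [hγ, ← hy, map_smul]⟩

lemma IsLoc.of_subsingleton {X Y : Type*} [AddCommGroup X] [Module R X] [AddCommGroup Y]
    [Module A Y] [Subsingleton X] [Subsingleton Y] :
    IsLoc S (0 : X →ₛₗ[algebraMap R A] Y) where
  exists_smul_eq_zero _ _ := ⟨1, S.one_mem, Subsingleton.elim _ _⟩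
  exists_smul_eq _ := ⟨1, S.one_mem, 0, Subsingleton.elim _ _⟩

end IsLoc

section Localization

variable {R : Type u} [CommRing R] (S : Submonoid R)

/-- The localization map of a module, as a semilinear map. -/
def locMk (M : Type u) [AddCommGroup M] [Module R M] :
    M →ₛₗ[algebraMap R (Localization S)] LocalizedModule S M where
  toFun m := LocalizedModule.mk m 1
  map_add' := (LocalizedModule.mkLinearMap S M).map_add
  map_smul' r m := by
    rw [algebraMap_smul]
    exact (LocalizedModule.mkLinearMap S M).map_smul r m

lemma isLoc_locMk (M : Type u) [AddCommGroup M] [Module R M] : IsLoc S (locMk S M) where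
  exists_smul_eq_zero x hx := by
    obtain ⟨s, hs⟩ := (IsLocalizedModule.eq_zero_iff S (LocalizedModule.mkLinearMap S M)).1 hx
    exact ⟨s, s.2, hs⟩
  exists_smul_eq y := by
    obtain ⟨⟨x, s⟩, h⟩ := IsLocalizedModule.surj S (LocalizedModule.mkLinearMap S M) y
    refine ⟨s, s.2, x, ?_⟩
    rw [algebraMap_smul]
    exact h

variable {S} (a : Ideal R)

lemma mem_powTorsion_map {N : Type*} [AddCommGroup N] [Module (Localization S) N] {n : N} {t : ℕ}
    (h : ∀ r ∈ a ^ t, algebraMap R (Localization S) r • n = 0) :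
    n ∈ powTorsion (a.map (algebraMap R (Localization S))) N := by
  refine ⟨t, fun r hr => ?_⟩
  rw [← Ideal.map_pow] at hr
  refine Submodule.span_induction (p := fun r _ => r • n = 0) ?_ (zero_smul _ _)
    (fun x y _ _ hx hy => by rw [add_smul, hx, hy, add_zero])
    (fun c x _ hx => by rw [smul_assoc, hx, smul_zero]) hr
  rintro _ ⟨r, hr, rfl⟩
  exact h r hr

variable (S) in
/-- Localization of the torsion submodule. -/
def locPowTorsion (M : Type u) [AddCommGroup M] [Module R M] :
    powTorsion a M →ₛₗ[algebraMap R (Localization S)]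
      powTorsion (a.map (algebraMap R (Localization S))) (LocalizedModule S M) :=
  ((locMk S M).comp (powTorsion a M).subtype).codRestrict _ fun x => by
    obtain ⟨t, ht⟩ := x.2
    refine mem_powTorsion_map (t := t) a fun r hr => ?_
    rw [← map_smulₛₗ]
    have : r • x = 0 := Subtype.ext (ht r hr)
    rw [this, map_zero]

lemma isLoc_locPowTorsion [IsNoetherianRing R] (M : Type u) [AddCommGroup M] [Module R M] :
    IsLoc S (locPowTorsion S a M) where
  exists_smul_eq_zero x hx := by
    obtain ⟨s, hs, h⟩ := (isLoc_locMk S M).exists_smul_eq_zero x (congr_arg Subtype.val hx)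
    exact ⟨s, hs, Subtype.ext h⟩
  exists_smul_eq y := by
    obtain ⟨y, t, ht⟩ := y
    obtain ⟨s, hs, x, h⟩ := (isLoc_locMk S M).exists_smul_eq y
    have key (I : Ideal R) (hI : I.FG) (hIa : I ≤ a ^ t) : ∃ s ∈ S, ∀ r ∈ I, s • r • x = 0 := by
      induction I, hI using Submodule.fg_induction with
      | singleton r =>
        have hr := hIa (Submodule.mem_span_singleton_self r)
        obtain ⟨s', hs', h'⟩ := (isLoc_locMk S M).exists_smul_eq_zero (r • x) (by
          rw [map_smulₛₗ, ← h, smul_comm, ht _ (by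
            rw [← Ideal.map_pow]; exact Ideal.mem_map_of_mem _ hr), smul_zero])
        refine ⟨s', hs', fun c hc => ?_⟩
        obtain ⟨d, rfl⟩ := Submodule.mem_span_singleton.1 hc
        rw [smul_assoc, smul_comm, h', smul_zero]
      | sup N₁ N₂ _ _ h₁ h₂ =>
        obtain ⟨s₁, hs₁, h₁⟩ := h₁ (le_sup_left.trans hIa)
        obtain ⟨s₂, hs₂, h₂⟩ := h₂ (le_sup_right.trans hIa)
        refine ⟨s₁ * s₂, S.mul_mem hs₁ hs₂, fun r hr => ?_⟩
        obtain ⟨y₁, hy₁, y₂, hy₂, rfl⟩ := Submodule.mem_sup.1 hr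
        rw [add_smul, smul_add, mul_smul, mul_smul, h₂ _ hy₂, smul_comm s₁, h₁ _ hy₁, smul_zero,
          smul_zero, add_zero]
    obtain ⟨s', hs', h'⟩ := key (a ^ t) (IsNoetherian.noetherian _) le_rfl
    refine ⟨s' * s, S.mul_mem hs' hs,
      ⟨s' • x, t, fun r hr => by rw [smul_comm, h' r hr]⟩, Subtype.ext ?_⟩
    change algebraMap R (Localization S) (s' * s) • y = locMk S M (s' • x)
    rw [map_smulₛₗ, map_mul, mul_smul, h]

variable {a} in
/-- The identification of `H⁰` with the torsion submodule. -/
def H.equiv (M : Type u) [AddCommGroup M] [Module R M] : H a 0 M ≃ₗ[R] powTorsion a M :=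
  (LinearEquiv.ofInjective (H.eval a M) H.eval_injective).trans
    (LinearEquiv.ofEq _ _ (range_eval M))

variable {a} in
lemma H.coe_equiv {M : Type u} [AddCommGroup M] [Module R M] (x : H a 0 M) :
    (H.equiv M x : M) = H.eval a M x := rfl

variable (S) [IsNoetherianRing R]

theorem exists_isLoc (i : ℕ) (M : Type u) [AddCommGroup M] [Module R M] :
    ∃ f : H a i M →ₛₗ[algebraMap R (Localization S)]
      H (a.map (algebraMap R (Localization S))) i (LocalizedModule S M), IsLoc S f := by
  let φ (M : Type u) [AddCommGroup M] [Module R M] :=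
    (((H.equiv (a := a.map (algebraMap R (Localization S)))
      (LocalizedModule S M)).symm.toLinearMap.comp (locPowTorsion S a M)).comp
      (H.equiv M).toLinearMap)
  have hφ (M : Type u) [AddCommGroup M] [Module R M] : IsLoc S (φ M) :=
    (isLoc_locPowTorsion a M).of_linearEquiv (H.equiv M) (H.equiv _).symm
  have hφe (M : Type u) [AddCommGroup M] [Module R M] (x : H a 0 M) :
      H.eval _ _ (φ M x) = locMk S M (H.eval a M x) := by
    rw [← H.coe_equiv]
    exact congr_arg Subtype.val ((H.equiv _).apply_symm_apply (locPowTorsion S a M (H.equiv M x)))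
  cases i with
  | zero => exact ⟨φ M, hφ M⟩
  | succ i =>
  induction i generalizing M with
  | zero => ?_
  | succ i ih => ?_
  all_goals
    obtain ⟨E, ι, hE, hι⟩ := exists_injective_hull (R := R) M
    have hg := (LinearMap.range ι).mkQ_surjective
    have hfg := LinearMap.exact_map_mkQ_range ι
    have : Module.Injective (Localization S) (LocalizedModule S E) :=
      Module.injective_of_isLocalizedModule S (LocalizedModule.mkLinearMap S E)
    have hι' := LocalizedModule.map_injective S _ hι
    have hg' := LocalizedModule.map_surjective S _ hg
    have hfg' : Function.Exact (LocalizedModule.map S ι) (LocalizedModule.map S _) :=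
      LocalizedModule.map_exact S _ _ hfg
    have hsub (j : ℕ) : Subsingleton (H a (j + 1) E) := H.subsingleton_of_injective
    have hsub' (j : ℕ) : Subsingleton
      (H (a.map (algebraMap R (Localization S))) (j + 1) (LocalizedModule S E)) :=
      H.subsingleton_of_injective
  · refine IsLoc.exists_of_exact (H.exact_map_δ (a := a) (j := 0) hι hfg hg)
      (fun x => (H.exact_δ_map hι hfg hg x).1 (Subsingleton.elim _ _))
      (H.exact_map_δ (a := a.map (algebraMap R (Localization S))) (j := 0) hι' hfg' hg')
      (fun x => (H.exact_δ_map hι' hfg' hg' x).1 (Subsingleton.elim _ _)) (hφ _) (hφ _)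
      fun x => H.eval_injective ?_
    rw [hφe, H.eval_map, H.eval_map, hφe]
    exact (LocalizedModule.map_mk S _ _ _).symm
  · obtain ⟨β, hβ⟩ := ih (E ⧸ LinearMap.range ι)
    exact IsLoc.exists_of_exact (H.exact_map_δ (a := a) (j := i + 1) hι hfg hg)
      (fun x => (H.exact_δ_map hι hfg hg x).1 (Subsingleton.elim _ _))
      (H.exact_map_δ (a := a.map (algebraMap R (Localization S))) (j := i + 1) hι' hfg' hg')
      (fun x => (H.exact_δ_map hι' hfg' hg' x).1 (Subsingleton.elim _ _))
      (IsLoc.of_subsingleton (X := H a (i + 1) E)) hβ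
      fun x => by rw [Subsingleton.elim x 0, map_zero, map_zero, map_zero, map_zero]

end Localization

section Artinian

variable {R : Type*} [CommRing R]

lemma mem_torsionBySet {X : Type*} [AddCommGroup X] [Module R X] {s : Set R} {x : X} :
    x ∈ Submodule.torsionBySet R X s ↔ ∀ r ∈ s, r • x = 0 := by
  simp [Submodule.mem_torsionBySet_iff]

variable {X : Type*} [AddCommGroup X] [Module R X]

/-- Melkersson's criterion for a single element. -/
lemma isArtinian_of_ker_smul (x : R) (hx : ∀ k : X, ∃ n : ℕ, x ^ n • k = 0)
    [IsArtinian R (LinearMap.ker (LinearMap.lsmul R X x))] : IsArtinian R X := by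
  rw [← monotone_stabilizes_iff_artinian]
  intro K
  let K' (n : ℕ) : Submodule R X := OrderDual.ofDual (K n)
  have hK {m n : ℕ} (h : m ≤ n) : K' n ≤ K' m := K.monotone h
  let T := LinearMap.ker (LinearMap.lsmul R X x)
  let L (n j : ℕ) : Submodule R T :=
    ((K' n ⊓ LinearMap.ker (LinearMap.lsmul R X (x ^ (j + 1)))).map
      (LinearMap.lsmul R X (x ^ j))).comap T.subtype
  have mem_L {n j : ℕ} {t : T} :
      t ∈ L n j ↔ ∃ k ∈ K' n, x ^ (j + 1) • k = 0 ∧ x ^ j • k = t := by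
    constructor
    · rintro ⟨k, ⟨h1, h2⟩, h3⟩
      exact ⟨k, h1, h2, h3⟩
    · rintro ⟨k, h1, h2, h3⟩
      exact ⟨k, ⟨h1, h2⟩, h3⟩
  have hL1 {m n j : ℕ} (h : m ≤ n) : L n j ≤ L m j := fun t ht => by
    obtain ⟨k, h1, h2⟩ := mem_L.1 ht
    exact mem_L.2 ⟨k, hK h h1, h2⟩
  have hL2 {n i j : ℕ} (h : i ≤ j) : L n j ≤ L n i := by
    induction j, h using Nat.le_induction with
    | base => exact le_rfl
    | succ j _ ih =>
      refine le_trans (fun t ht => ?_) ih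
      obtain ⟨k, h1, h2, h3⟩ := mem_L.1 ht
      refine mem_L.2 ⟨x • k, (K' n).smul_mem _ h1, ?_, ?_⟩
      · rw [smul_smul, ← pow_succ, h2]
      · rw [smul_smul, ← pow_succ, h3]
  obtain ⟨N, hN⟩ := IsArtinian.monotone_stabilizes (R := R) (M := T)
    ⟨fun n => OrderDual.toDual (L n n), fun m n h => (hL1 h).trans (hL2 h)⟩
  have hrow (j : ℕ) : ∃ n₀, ∀ n ≥ n₀, L n₀ j ≤ L n j := by
    obtain ⟨n₀, h⟩ := IsArtinian.monotone_stabilizes (R := R) (M := T)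
      ⟨fun n => OrderDual.toDual (L n j), fun m n h => hL1 h⟩
    exact ⟨n₀, fun n hn => (show L n₀ j = L n j from h n hn).le⟩
  choose n₀ hn₀ using hrow
  obtain ⟨N', hN', hN''⟩ : ∃ N', N ≤ N' ∧ ∀ j < N, n₀ j ≤ N' :=
    ⟨max N ((Finset.range N).sup n₀), le_max_left _ _, fun j hj =>
      (Finset.le_sup (Finset.mem_range.2 hj)).trans (le_max_right _ _)⟩
  have key (j n : ℕ) (hn : N' ≤ n) : L N' j ≤ L n j := by
    rcases lt_or_ge j N with hj | hj
    · exact (hL1 (hN'' j hj)).trans (hn₀ j n ((hN'' j hj).trans hn))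
    · have h1 : L N N ≤ L (max n j) (max n j) :=
        (show L N N = L (max n j) (max n j) from
          hN (max n j) ((hN'.trans hn).trans (le_max_left _ _))).le
      exact (((hL1 hN').trans (hL2 hj)).trans h1).trans
        ((hL1 (le_max_left _ _)).trans (hL2 (le_max_right _ _)))
  refine ⟨N', fun n hn => le_antisymm (K.monotone hn) ?_⟩
  change K' N' ≤ K' n
  have (j : ℕ) (k : X) (hk : k ∈ K' N') (h : x ^ j • k = 0) : k ∈ K' n := by
    induction j generalizing k with
    | zero =>
      rw [pow_zero, one_smul] at h
      exact h ▸ zero_mem _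
    | succ j ih =>
      obtain ⟨k', h1, h2, h3⟩ := mem_L.1 (key j n hn (mem_L.2 ⟨k, hk, h, rfl⟩ :
        (⟨x ^ j • k, by
          change x • x ^ j • k = 0
          rw [smul_smul, ← pow_succ', h]⟩ : T) ∈ L N' j))
      have := ih (k - k') (sub_mem hk (hK hn h1)) (by rw [smul_sub, h3, sub_self])
      simpa using add_mem this h1
  intro k hk
  obtain ⟨j, hj⟩ := hx k
  exact this j k hk hj

lemma isArtinian_of_torsionBySet_finset (s : Finset R)
    (hs : ∀ x ∈ s, ∀ k : X, ∃ n : ℕ, x ^ n • k = 0)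
    (h : IsArtinian R (Submodule.torsionBySet R X (s : Set R))) : IsArtinian R X := by
  classical
  induction s using Finset.induction_on with
  | empty =>
    refine isArtinian_of_surjective _
      (Submodule.torsionBySet R X ((∅ : Finset R) : Set R)).subtype ?_
    intro x
    exact ⟨⟨x, mem_torsionBySet.2 (by simp)⟩, rfl⟩
  | insert x s _ ih =>
    refine ih (fun y hy => hs y (Finset.mem_insert_of_mem hy)) ?_
    have : IsArtinian R
        (LinearMap.ker (LinearMap.lsmul R (Submodule.torsionBySet R X (s : Set R)) x)) := by
      let f : LinearMap.ker (LinearMap.lsmul R (Submodule.torsionBySet R X (s : Set R)) x) →ₗ[R]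
          Submodule.torsionBySet R X ((insert x s : Finset R) : Set R) :=
        (Submodule.subtype _ ∘ₗ Submodule.subtype _).codRestrict _ (by
          rintro ⟨⟨y, hy⟩, hy'⟩
          rw [mem_torsionBySet]
          intro r hr
          rw [Finset.mem_coe, Finset.mem_insert] at hr
          rcases hr with rfl | hr
          · exact congr_arg Subtype.val hy'
          · exact mem_torsionBySet.1 hy r hr)
      exact isArtinian_of_injective f fun y z hyz => Subtype.ext (Subtype.ext
        (show (f y : X) = f z from congr_arg Subtype.val hyz))
    refine isArtinian_of_ker_smul x fun k => ?_
    obtain ⟨n, hn⟩ := hs x (Finset.mem_insert_self _ _) k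
    exact ⟨n, Subtype.ext hn⟩

/-- Melkersson's criterion. -/
theorem isArtinian_of_torsionBySet {a : Ideal R} (ha : a.FG) (hX : powTorsion a X = ⊤)
    (h : IsArtinian R (Submodule.torsionBySet R X a)) : IsArtinian R X := by
  obtain ⟨s, rfl⟩ := ha
  rw [← Submodule.torsionBySet_eq_torsionBySet_span] at h
  refine isArtinian_of_torsionBySet_finset s (fun x hx k => ?_) h
  obtain ⟨t, ht⟩ := (hX ▸ Submodule.mem_top : k ∈ powTorsion _ X)
  exact ⟨t, ht _ (Ideal.pow_mem_pow (Ideal.subset_span hx) _)⟩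

lemma isArtinian_of_fg_of_smul_eq_zero (m : Ideal R) [m.IsMaximal] {N : Submodule R X} (hN : N.FG)
    (h : ∀ r ∈ m, ∀ x ∈ N, r • x = 0) : IsArtinian R N := by
  induction N, hN using Submodule.fg_induction with
  | singleton x =>
    have : IsSimpleModule R (R ⧸ m) := isSimpleModule_iff_isCoatom.2 (Ideal.isMaximal_def.1 ‹_›)
    rw [← LinearMap.range_toSpanSingleton]
    let f : (R ⧸ m) →ₗ[R] X := m.liftQ (LinearMap.toSpanSingleton R X x) fun r hr =>
      h r hr x (Submodule.mem_span_singleton_self x)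
    rw [← Submodule.range_liftQ m (LinearMap.toSpanSingleton R X x) fun r hr =>
      h r hr x (Submodule.mem_span_singleton_self x)]
    infer_instance
  | sup N₁ N₂ _ _ h₁ h₂ =>
    have := h₁ fun r hr x hx => h r hr x (le_sup_left (a := N₁) hx)
    have := h₂ fun r hr x hx => h r hr x (le_sup_right (a := N₁) hx)
    infer_instance

variable [IsNoetherianRing R]

/-- A minimax module all of whose elements are killed by powers of a maximal ideal is Artinian. -/
lemma isArtinian_of_isMinimax (m : Ideal R) [m.IsMaximal] (hX : powTorsion m X = ⊤)
    (h : IsMinimax R X) : IsArtinian R X := by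
  obtain ⟨N, hN, hN'⟩ := h
  rw [isArtinian_iff_submodule_quotient N]
  refine ⟨isArtinian_of_torsionBySet (a := m) (IsNoetherian.noetherian m) ?_ ?_, hN'⟩
  · rw [eq_top_iff]
    exact fun x _ => mem_powTorsion_of_injective N.subtype N.injective_subtype
      (hX ▸ Submodule.mem_top)
  · have : IsNoetherian R N := isNoetherian_of_fg_of_noetherian N hN
    exact isArtinian_of_fg_of_smul_eq_zero m (IsNoetherian.noetherian _)
      fun r hr x hx => mem_torsionBySet.1 hx r hr

lemma mem_powTorsion_of_isArtinian [IsLocalRing R] [IsArtinian R X] (x : X) :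
    x ∈ powTorsion (IsLocalRing.maximalIdeal R) X := by
  obtain ⟨n, hn⟩ := IsArtinian.monotone_stabilizes (R := R) (M := X)
    ⟨fun t => OrderDual.toDual ((IsLocalRing.maximalIdeal R) ^ t • Submodule.span R {x}),
      fun s t h => Submodule.smul_mono_left (Ideal.pow_le_pow_right h)⟩
  have h : (IsLocalRing.maximalIdeal R) ^ n • Submodule.span R {x} ≤
      IsLocalRing.maximalIdeal R • (IsLocalRing.maximalIdeal R) ^ n • Submodule.span R {x} := by
    rw [← Submodule.mul_smul, ← pow_succ']
    exact (congr_arg OrderDual.ofDual (hn (n + 1) n.le_succ)).le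
  have hfg : ((IsLocalRing.maximalIdeal R) ^ n • Submodule.span R {x}).FG := by
    exact Submodule.FG.of_le (Submodule.fg_span_singleton x) Submodule.smul_le_right
  have h0 := Submodule.eq_bot_of_le_smul_of_le_jacobson_bot _ _ hfg h
    (IsLocalRing.maximalIdeal_le_jacobson _)
  refine ⟨n, fun r hr => ?_⟩
  rw [← Submodule.mem_bot R, ← h0]
  exact Submodule.smul_mem_smul hr (Submodule.mem_span_singleton_self x)

end Artinian

section FiniteAss

open IsLocalRing

variable {R : Type*} [CommRing R] [IsNoetherianRing R] {X : Type*} [AddCommGroup X] [Module R X]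

lemma exists_annihilator_of_isAssociatedPrime {p : Ideal R} (hp : IsAssociatedPrime p X) :
    ∃ z : X, ∀ r, r ∈ p ↔ r • z = 0 := by
  obtain ⟨-, z, hz⟩ := isAssociatedPrime_iff.1 hp
  exact ⟨z, fun r => by rw [hz, Submodule.mem_colon_singleton, Submodule.mem_bot]⟩

lemma isAssociatedPrime_of_forall_mem_iff {p : Ideal R} (h : p.IsPrime) (z : X)
    (hz : ∀ r, r ∈ p ↔ r • z = 0) : IsAssociatedPrime p X :=
  isAssociatedPrime_iff.2 ⟨h, z, by
    ext r
    rw [hz, Submodule.mem_colon_singleton, Submodule.mem_bot]⟩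

lemma le_of_isAssociatedPrime {a : Ideal R} (hX : powTorsion a X = ⊤) {p : Ideal R}
    (hp : IsAssociatedPrime p X) : a ≤ p := by
  obtain ⟨z, hz⟩ := exists_annihilator_of_isAssociatedPrime hp
  obtain ⟨t, ht⟩ := (hX ▸ Submodule.mem_top : z ∈ powTorsion a X)
  exact hp.isPrime.le_of_pow_le fun r hr => (hz r).2 (ht r hr)

variable [IsLocalRing R]

lemma finite_associatedPrimes_of_isMinimax (h : IsMinimax R X) :
    (associatedPrimes R X).Finite := by
  obtain ⟨N, hN, hN'⟩ := h
  have : Module.Finite R N := Module.Finite.iff_fg.2 hN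
  refine ((associatedPrimes.finite R N).union (Set.finite_singleton (maximalIdeal R))).subset
    ((associatedPrimes.subset_union_of_exact N.injective_subtype
      (LinearMap.exact_subtype_mkQ N)).trans (Set.union_subset_union_right _ ?_))
  intro p hp
  have hle := le_of_isAssociatedPrime (a := maximalIdeal R)
    (eq_top_iff.2 fun x _ => mem_powTorsion_of_isArtinian x) hp
  exact ((maximalIdeal.isMaximal R).eq_of_le hp.isPrime.ne_top hle).symm

lemma finite_associatedPrimes_of_torsionBySet {a : Ideal R} (hX : powTorsion a X = ⊤)
    (hT : IsMinimax R (Submodule.torsionBySet R X a)) : (associatedPrimes R X).Finite := by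
  refine (finite_associatedPrimes_of_isMinimax hT).subset fun p hp => ?_
  have hle := le_of_isAssociatedPrime hX hp
  obtain ⟨z, hz⟩ := exists_annihilator_of_isAssociatedPrime hp
  refine isAssociatedPrime_of_forall_mem_iff hp.isPrime
    ⟨z, (Submodule.mem_torsionBySet_iff _ _).2 fun r => (hz r).1 (hle r.2)⟩ fun r => ?_
  rw [hz, Subtype.ext_iff]
  rfl

lemma isAssociatedPrime_of_quotient_powTorsion {p : Ideal R}
    (hp : IsAssociatedPrime p (X ⧸ powTorsion (maximalIdeal R) X)) :
    IsAssociatedPrime p X ∧ p ≠ maximalIdeal R := by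
  have hprime := hp.isPrime
  obtain ⟨z, hz⟩ := exists_annihilator_of_isAssociatedPrime hp
  have hne : p ≠ maximalIdeal R := by
    rintro rfl
    have : z ∈ powTorsion (maximalIdeal R) (X ⧸ powTorsion (maximalIdeal R) X) :=
      ⟨1, fun r hr => (hz r).1 (by rwa [pow_one] at hr)⟩
    rw [powTorsion_quotient, Submodule.mem_bot] at this
    exact hprime.ne_top ((Ideal.eq_top_iff_one _).2 ((hz 1).2 (by rw [this, smul_zero])))
  refine ⟨?_, hne⟩
  obtain ⟨z, rfl⟩ := Submodule.mkQ_surjective _ z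
  replace hz (r : R) : r ∈ p ↔ r • z ∈ powTorsion (maximalIdeal R) X := by
    rw [hz, ← map_smul, Submodule.mkQ_apply, Submodule.Quotient.mk_eq_zero]
  obtain ⟨t, ht⟩ := exists_pow_smul_eq_zero_of_fg (a := maximalIdeal R)
    (N := Submodule.map (LinearMap.toSpanSingleton R X z) p)
    (Submodule.FG.map _ (IsNoetherian.noetherian p)) (by
      rintro _ ⟨r, hr, rfl⟩
      exact (hz r).1 hr)
  obtain ⟨s, hs, hsp⟩ : ∃ s ∈ maximalIdeal R, s ∉ p := by
    by_contra! h
    exact hne ((maximalIdeal.isMaximal R).eq_of_le hprime.ne_top h).symm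
  refine isAssociatedPrime_of_forall_mem_iff hprime (s ^ t • z)
    fun r => ⟨fun hr => ?_, fun hr => ?_⟩
  · rw [smul_comm]
    exact ht _ (Ideal.pow_mem_pow hs t) _ ⟨r, hr, rfl⟩
  · rw [smul_smul] at hr
    refine (hprime.mem_or_mem ((hz (r * s ^ t)).2 ?_)).resolve_right
      fun h => hsp (hprime.mem_of_pow_mem _ h)
    rw [hr]
    exact zero_mem _

lemma isMinimax_torsionBySet_pow {R : Type*} [CommRing R] [IsNoetherianRing R] {X : Type*}
    [AddCommGroup X] [Module R X] {a : Ideal R}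
    (hT : IsMinimax R (Submodule.torsionBySet R X a)) (n : ℕ) :
    IsMinimax R (Submodule.torsionBySet R X (a ^ n : Ideal R)) := by
  induction n with
  | zero =>
    have : Subsingleton (Submodule.torsionBySet R X (a ^ 0 : Ideal R)) :=
      subsingleton_of_forall_eq 0 fun x => Subtype.ext <| by
        simpa using (Submodule.mem_torsionBySet_iff _ _).1 x.2 ⟨1, by simp⟩
    exact .of_subsingleton
  | succ n ih =>
    refine IsMinimax.of_smul_mem (J := a) (fun r hr x hx => ?_) ih (.of_le inf_le_right hT)
    rw [Submodule.mem_torsionBySet_iff] at hx ⊢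
    intro s
    rw [smul_smul]
    exact hx ⟨s * r, pow_succ a n ▸ Ideal.mul_mem_mul s.2 hr⟩

/-- An `a`-torsion module over a Noetherian local ring, whose elements killed by `a` form a minimax
module, is minimax as soon as it is locally killed by a power of `a` at each nonmaximal associated
prime. -/
theorem isMinimax_of_forall_isAssociatedPrime {a : Ideal R} (hX : powTorsion a X = ⊤)
    (hT : IsMinimax R (Submodule.torsionBySet R X a))
    (h : ∀ p : Ideal R, IsAssociatedPrime p X → p ≠ maximalIdeal R →
      ∃ t : ℕ, ∀ r ∈ a ^ t, ∀ x : X, ∃ s ∉ p, s • r • x = 0) : IsMinimax R X := by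
  have hfin := finite_associatedPrimes_of_torsionBySet hX hT
  choose! t ht using h
  let n := hfin.toFinset.sup t
  have hK : (a ^ n • ⊤ : Submodule R X) ≤ powTorsion (maximalIdeal R) X := by
    refine Submodule.smul_le.2 fun r hr x _ => ?_
    by_contra hx
    obtain ⟨p, hp, hle⟩ := exists_le_isAssociatedPrime_of_isNoetherianRing R
      ((powTorsion (maximalIdeal R) X).mkQ (r • x))
      (by rwa [Submodule.mkQ_apply, ne_eq, Submodule.Quotient.mk_eq_zero])
    obtain ⟨hp, hne⟩ := isAssociatedPrime_of_quotient_powTorsion hp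
    have hpn : t p ≤ n := Finset.le_sup (f := t) (hfin.mem_toFinset.2 hp)
    obtain ⟨s, hs, hs0⟩ := ht p hp hne r (Ideal.pow_le_pow_right hpn hr) x
    refine hs (hle ?_)
    rw [Submodule.mem_colon_singleton, ← map_smul, hs0, map_zero]
    exact zero_mem _
  have hart : IsArtinian R (a ^ n • ⊤ : Submodule R X) := by
    refine isArtinian_of_torsionBySet (a := a) (IsNoetherian.noetherian a) ?_ ?_
    · exact eq_top_iff.2 fun x _ => mem_powTorsion_of_injective (Submodule.subtype _)
        (Submodule.injective_subtype _) (hX.ge Submodule.mem_top)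
    · refine isArtinian_of_isMinimax (maximalIdeal R) ?_ ?_
      · exact eq_top_iff.2 fun x _ => mem_powTorsion_of_injective
          (Submodule.subtype _ ∘ₗ Submodule.subtype _)
          ((Submodule.injective_subtype _).comp (Submodule.injective_subtype _)) (hK x.1.2)
      · let f : Submodule.torsionBySet R (a ^ n • ⊤ : Submodule R X) a →ₗ[R]
            Submodule.torsionBySet R X a :=
          (Submodule.subtype _ ∘ₗ Submodule.subtype _).codRestrict _ fun x =>
            (Submodule.mem_torsionBySet_iff _ _).2 fun r =>
              congr_arg Subtype.val ((Submodule.mem_torsionBySet_iff _ _).1 x.2 r)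
        exact .of_injective f (fun x y hxy => Subtype.ext (Subtype.ext
          (show (f x : X) = f y from congr_arg Subtype.val hxy))) hT
  have htop : IsMinimax R (⊤ : Submodule R X) :=
    IsMinimax.of_smul_mem (J := a ^ n) (K := a ^ n • ⊤)
      (fun r hr x hx => Submodule.smul_mem_smul hr hx) .of_isArtinian
      (.of_le inf_le_right (isMinimax_torsionBySet_pow hT n))
  exact .of_surjective (Submodule.subtype ⊤) (fun x => ⟨⟨x, Submodule.mem_top⟩, rfl⟩) htop

end FiniteAss

section Main

variable {R : Type u} [CommRing R] [IsNoetherianRing R]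

omit [IsNoetherianRing R] in
lemma H.powTorsion_eq_top (a : Ideal R) (j : ℕ) (M : Type u) [AddCommGroup M] [Module R M] :
    powTorsion a (H a j M) = ⊤ :=
  eq_top_iff.2 fun x _ => LC.exists_pow_smul_eq_zero x

lemma exists_smul_smul_eq_zero (a : Ideal R) (j : ℕ) (M : Type u) [AddCommGroup M] [Module R M]
    (S : Submonoid R) [Module.Finite (Localization S)
      (H (a.map (algebraMap R (Localization S))) j (LocalizedModule S M))] :
    ∃ t : ℕ, ∀ r ∈ a ^ t, ∀ x : H a j M, ∃ s ∈ S, s • r • x = 0 := by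
  have : IsNoetherianRing (Localization S) := IsLocalization.isNoetherianRing S _ ‹_›
  obtain ⟨f, hf⟩ := exists_isLoc S a j M
  obtain ⟨t, ht⟩ := exists_pow_smul_eq_zero_of_fg (a := a.map (algebraMap R (Localization S)))
    (N := (⊤ : Submodule (Localization S) (H (a.map (algebraMap R (Localization S))) j
      (LocalizedModule S M)))) Module.Finite.fg_top (H.powTorsion_eq_top _ _ _).ge
  refine ⟨t, fun r hr x => hf.exists_smul_eq_zero _ ?_⟩
  rw [map_smulₛₗ]
  refine ht _ ?_ _ Submodule.mem_top
  rw [← Ideal.map_pow]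
  exact Ideal.mem_map_of_mem _ hr

lemma mem_support_of_isAssociatedPrime {a : Ideal R} {j : ℕ} {M : Type u} [AddCommGroup M]
    [Module R M] [Module.Finite R M] (p : PrimeSpectrum R)
    (hp : IsAssociatedPrime p.asIdeal (H a j M)) :
    p ∈ Module.support R (M ⧸ (a • ⊤ : Submodule R M)) := by
  rw [Module.support_quotient]
  refine ⟨?_, le_of_isAssociatedPrime (H.powTorsion_eq_top a j M) hp⟩
  rw [Module.mem_support_iff]
  by_contra h
  rw [not_nontrivial_iff_subsingleton] at h
  obtain ⟨f, hf⟩ := exists_isLoc p.asIdeal.primeCompl a j M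
  obtain ⟨z, hz⟩ := exists_annihilator_of_isAssociatedPrime hp
  have := H.subsingleton (R := Localization p.asIdeal.primeCompl)
    (a := a.map (algebraMap R (Localization p.asIdeal.primeCompl))) (j := j)
    (A := LocalizedModule p.asIdeal.primeCompl M)
  obtain ⟨s, hs, hs0⟩ := hf.exists_smul_eq_zero z (Subsingleton.elim _ _)
  exact hs ((hz s).2 hs0)

omit [IsNoetherianRing R] in
lemma one_le_ringKrullDim_quotient_iff [IsLocalRing R] (p : Ideal R) [p.IsPrime] :
    1 ≤ ringKrullDim (R ⧸ p) ↔ p ≠ IsLocalRing.maximalIdeal R := by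
  constructor
  · rintro h rfl
    rw [ringKrullDim_eq_zero_of_isField ((Ideal.Quotient.maximal_ideal_iff_isField_quotient _).1
      (IsLocalRing.maximalIdeal.isMaximal R))] at h
    exact absurd h (by decide)
  · intro h
    by_contra! h1
    have : Ring.KrullDimLE 0 (R ⧸ p) := by
      rw [Ring.krullDimLE_iff]
      generalize ringKrullDim (R ⧸ p) = d at h1
      induction d using WithBot.recBotCoe with
      | bot => exact bot_le
      | coe d =>
        have hd : d = 0 := Order.lt_one_iff.1 (WithBot.coe_lt_coe.1 h1)
        exact hd ▸ le_rfl
    exact h (IsLocalRing.eq_maximalIdeal (Ideal.Quotient.maximal_of_isField p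
      Ring.KrullDimLE.isField_of_isDomain))

theorem isMinimax_of_forall_finite [IsLocalRing R] (a : Ideal R) (M : Type u) [AddCommGroup M]
    [Module R M] [Module.Finite R M] (i : ℕ)
    (h : ∀ j ≤ i, ∀ p : PrimeSpectrum R, p ∈ Module.support R (M ⧸ (a • ⊤ : Submodule R M)) →
      1 ≤ ringKrullDim (R ⧸ p.asIdeal) →
      Module.Finite (Localization.AtPrime p.asIdeal)
        (H (a.map (algebraMap R (Localization.AtPrime p.asIdeal))) j
          (LocalizedModule p.asIdeal.primeCompl M))) :
    IsMinimax R (H a i M) := by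
  induction i using Nat.strong_induction_on with
  | _ i ih =>
    refine isMinimax_of_forall_isAssociatedPrime (H.powTorsion_eq_top a i M)
      (isMinimax_torsionBySet i M (fun l _ => IsMinimax.ext _ _ .of_finite l)
        fun j hj => ih j hj fun k hk => h k (hk.trans hj.le)) fun p hp hne => ?_
    have := hp.isPrime
    have := h i le_rfl ⟨p, hp.isPrime⟩ (mem_support_of_isAssociatedPrime ⟨p, hp.isPrime⟩ hp)
      ((one_le_ringKrullDim_quotient_iff p).2 hne)
    exact exists_smul_smul_eq_zero a i M p.primeCompl

lemma finite_of_isMinimax [IsLocalRing R] (a : Ideal R) (M : Type u) [AddCommGroup M]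
    [Module R M] (j : ℕ) (S : Submonoid R) (s : R) (hsm : s ∈ IsLocalRing.maximalIdeal R)
    (hs : s ∈ S) (h : IsMinimax R (H a j M)) :
    Module.Finite (Localization S)
      (H (a.map (algebraMap R (Localization S))) j (LocalizedModule S M)) := by
  obtain ⟨N, ⟨F, hF⟩, hN⟩ := h
  obtain ⟨f, hf⟩ := exists_isLoc S a j M
  classical
  refine ⟨⟨F.image f, eq_top_iff.2 fun y _ => ?_⟩⟩
  have hunit {r : R} (hr : r ∈ S) {y} {P : Submodule (Localization S)
      (H (a.map (algebraMap R (Localization S))) j (LocalizedModule S M))}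
      (h : algebraMap R (Localization S) r • y ∈ P) : y ∈ P :=
    (P.smul_mem_iff_of_isUnit (IsLocalization.map_units _ (⟨r, hr⟩ : S))).1 h
  obtain ⟨r, hr, x, hx⟩ := hf.exists_smul_eq y
  refine hunit hr (hx ▸ ?_)
  obtain ⟨t, ht⟩ := mem_powTorsion_of_isArtinian (R := R) (N.mkQ x)
  refine hunit (pow_mem hs t) ?_
  rw [← map_smulₛₗ]
  have hmem : s ^ t • x ∈ N := by
    rw [← Submodule.Quotient.mk_eq_zero]
    exact ht _ (Ideal.pow_mem_pow hsm t)
  rw [← hF] at hmem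
  generalize s ^ t • x = x' at hmem
  induction hmem using Submodule.span_induction with
  | mem x hx => exact Submodule.subset_span (Finset.mem_coe.2 (Finset.mem_image_of_mem f hx))
  | zero => rw [_root_.map_zero]; exact zero_mem _
  | add x y _ _ hx hy => rw [map_add]; exact add_mem hx hy
  | smul r x _ hx => rw [map_smulₛₗ]; exact Submodule.smul_mem _ _ hx

end Main

end LocCoh

end

section Final

open LocCoh

variable {R : Type u} [CommRing R] (a : Ideal R) (M : Type u) [AddCommGroup M] [Module R M]

lemma finite_of_lt_fDim {j : ℕ} (h : (j : ℕ∞) < fDim R a M) : Module.Finite R (H a j M) := by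
  by_contra hj
  refine notMem_of_lt_csInf h (OrderBot.bddBelow _) ⟨j, rfl, fun hfin => hj ?_⟩
  obtain ⟨e⟩ := nonempty_linearEquiv_localCohomology a j (ModuleCat.of R M)
  exact Module.Finite.equiv e.symm

lemma isMinimax_localCohomology_iff [IsNoetherianRing R] (j : ℕ) :
    IsMinimax R ((localCohomology a j).obj (ModuleCat.of R M)) ↔ IsMinimax R (H a j M) := by
  obtain ⟨e⟩ := nonempty_linearEquiv_localCohomology a j (ModuleCat.of R M)
  exact ⟨.of_surjective e.symm.toLinearMap e.symm.surjective,
    .of_surjective e.toLinearMap e.surjective⟩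

end Final

theorem fDimN_one_eq_inf_not_minimax (R M : Type u) [CommRing R] [IsNoetherianRing R]
    [IsLocalRing R] [IsAdicComplete (IsLocalRing.maximalIdeal R) R]
    [AddCommGroup M] [Module R M] [Module.Finite R M] (a : Ideal R) :
    fDimN R a M 1 = sInf {i : ℕ∞ | ∃ j : ℕ, i = j ∧
      ¬ ∃ N : Submodule R ((localCohomology a j).obj (ModuleCat.of R M)), N.FG ∧
          IsArtinian R (((localCohomology a j).obj (ModuleCat.of R M)) ⧸ N)} := by
  apply le_antisymm
  · refine le_sInf ?_
    rintro _ ⟨i, rfl, hi⟩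
    by_contra! hlt
    refine hi ((isMinimax_localCohomology_iff a M i).2
      (LocCoh.isMinimax_of_forall_finite a M i fun j hj p hp hdim => ?_))
    refine finite_of_lt_fDim _ _ ((Nat.cast_le.2 hj).trans_lt (hlt.trans_le (sInf_le ?_)))
    exact ⟨p, hp, by exact_mod_cast hdim, rfl⟩
  · refine le_sInf ?_
    rintro _ ⟨p, -, hdim, rfl⟩
    refine le_sInf ?_
    rintro _ ⟨j, rfl, hj⟩
    refine sInf_le ⟨j, rfl, fun hmin => hj ?_⟩
    have hne := (LocCoh.one_le_ringKrullDim_quotient_iff p.asIdeal).1 (by exact_mod_cast hdim)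
    obtain ⟨s, hs, hsp⟩ : ∃ s ∈ IsLocalRing.maximalIdeal R, s ∉ p.asIdeal := by
      by_contra! h
      exact hne ((IsLocalRing.maximalIdeal.isMaximal R).eq_of_le p.isPrime.ne_top h).symm
    have := LocCoh.finite_of_isMinimax a M j p.asIdeal.primeCompl s hs hsp
      ((isMinimax_localCohomology_iff a M j).1 hmin)
    obtain ⟨e⟩ := LocCoh.nonempty_linearEquiv_localCohomology
      (a.map (algebraMap R (Localization.AtPrime p.asIdeal))) j
      (ModuleCat.of _ (LocalizedModule p.asIdeal.primeCompl M))
    exact Module.Finite.equiv e
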